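/- arXiv:1803.06602 — 11 statements merged into one kernel-verified Lean document; each statement's English description precedes it below -/
import Mathlib

section
/- Let q be a prime power, let a₁, …, aₙ be n distinct elements of F_{q²}, let v₁, …, vₙ be nonzero elements of F_{q²}, and let wᵢ = ∏_{1 ≤ j ≤ n, j ≠ i} (aᵢ − aⱼ)^{−1}. A codeword c = (v₁ f(a₁), …, vₙ f(aₙ)) of GRS_k(a, v) (with deg f ≤ k − 1) lies in the Hermitian dual GRS_k(a, v)^{⊥_H} if and only if there exists a polynomial g(x) ∈ F_{q²}[x] with deg g(x) ≤ n − k − 1 such that (v₁^{q+1} f(a₁)^q, …, vₙ^{q+1} f(aₙ)^q) = (w₁ g(a₁), …, wₙ g(aₙ)). -/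
open Polynomial in
/-- The sum of the values of a polynomial of degree less than `n` at `n` distinct nodes, weighted by
the inverses of the products of differences of nodes, is its coefficient of `X ^ (n - 1)`. -/
theorem sum_nodeWeight_mul_eval {F : Type*} [Field F] {n : ℕ} {a : Fin n → F}
    (ha : Function.Injective a) {P : F[X]} (hP : P.degree < n) :
    ∑ i, (∏ j ∈ Finset.univ.erase i, (a i - a j)⁻¹) * P.eval (a i) = P.coeff (n - 1) := by
  have h := Lagrange.coeff_eq_sum (s := Finset.univ) ha.injOn
    (P := P) (by simpa using hP)
  simp only [Finset.card_univ, Fintype.card_fin] at h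
  rw [h]
  refine Finset.sum_congr rfl fun i _ => ?_
  rw [Finset.prod_inv_distrib, div_eq_inv_mul]

open Polynomial in
/-- The Euclidean dual of a Reed–Solomon code of dimension `k` is a generalized Reed–Solomon code of
dimension `n - k`. -/
theorem forall_sum_mul_eval_eq_zero_iff {F : Type*} [Field F] {n k : ℕ} (hk : 1 ≤ k) (hkn : k ≤ n)
    {a : Fin n → F} (ha : Function.Injective a) {w : Fin n → F}
    (hw : ∀ i, w i = ∏ j ∈ Finset.univ.erase i, (a i - a j)⁻¹) (r : Fin n → F) :
    (∀ h : F[X], h.degree < k → ∑ i, r i * h.eval (a i) = 0) ↔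
      ∃ g : F[X], g.degree < (n - k : ℕ) ∧ ∀ i, r i = w i * g.eval (a i) := by
  have key {P : F[X]} (hP : P.degree < n) : ∑ i, w i * P.eval (a i) = P.coeff (n - 1) := by
    simp only [hw]
    exact sum_nodeWeight_mul_eval ha hP
  have hw0 (i : Fin n) : w i ≠ 0 := by
    rw [hw, Finset.prod_ne_zero_iff]
    intro j hj
    exact inv_ne_zero (sub_ne_zero.2 (ha.ne (Finset.ne_of_mem_erase hj).symm))
  constructor
  · intro H
    set g := Lagrange.interpolate Finset.univ a fun i => r i / w i with hg
    have hgn : g.degree < n := by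
      simpa only [Finset.card_univ, Fintype.card_fin] using
        Lagrange.degree_interpolate_lt (s := Finset.univ) (fun i => r i / w i) ha.injOn
    have hr (i : Fin n) : r i = w i * g.eval (a i) := by
      rw [hg, Lagrange.eval_interpolate_at_node _ ha.injOn (Finset.mem_univ i),
        mul_div_cancel₀ _ (hw0 i)]
    refine ⟨g, ?_, hr⟩
    by_contra! hdeg
    have hg0 : g ≠ 0 := by
      intro h0
      simp [h0] at hdeg
    rw [degree_eq_natDegree hg0, Nat.cast_lt] at hgn
    rw [degree_eq_natDegree hg0, Nat.cast_le] at hdeg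
    have hsum := H (X ^ (n - 1 - g.natDegree)) (by rw [degree_X_pow, Nat.cast_lt]; omega)
    have hcoeff := key (P := g * X ^ (n - 1 - g.natDegree)) (by
      rw [degree_mul, degree_X_pow, degree_eq_natDegree hg0]
      norm_cast
      omega)
    simp only [hr, mul_assoc, ← eval_mul] at hsum
    rw [hsum, coeff_mul_X_pow', if_pos (by omega),
      show n - 1 - (n - 1 - g.natDegree) = g.natDegree by omega] at hcoeff
    exact hg0 (leadingCoeff_eq_zero.1 hcoeff.symm)
  · rintro ⟨g, hg, hr⟩ h hh
    simp only [hr, mul_assoc, ← eval_mul]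
    have hdeg : (g * h).degree < (n - 1 : ℕ) := by
      rcases eq_or_ne g 0 with rfl | hg0
      · simp
      rcases eq_or_ne h 0 with rfl | hh0
      · simp
      rw [degree_eq_natDegree hg0, Nat.cast_lt] at hg
      rw [degree_eq_natDegree hh0, Nat.cast_lt] at hh
      rw [degree_mul, degree_eq_natDegree hg0, degree_eq_natDegree hh0]
      norm_cast
      omega
    rw [key (hdeg.trans_le (by exact_mod_cast Nat.sub_le n 1)), coeff_eq_zero_of_degree_lt hdeg]

/-- A codeword `c = (v₁ f(a₁), …, vₙ f(aₙ))` of `GRS_k(a, v)` lies in the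
Hermitian dual `GRS_k(a, v)^{⊥_H}` iff there exists `g` with `deg g ≤ n − k − 1` such that
`(v₁^{q+1} f(a₁)^q, …, vₙ^{q+1} f(aₙ)^q) = (w₁ g(a₁), …, wₙ g(aₙ))`. -/
theorem stmt_2 (p e q n k : ℕ) (hp : p.Prime) (he : 0 < e) (hq : q = p ^ e)
    (F : Type) [Field F] [Fintype F] [DecidableEq F] (hF : Fintype.card F = q ^ 2)
    (hk1 : 1 ≤ k) (hkn : k ≤ n)
    (a : Fin n → F) (ha : Function.Injective a)
    (v : Fin n → F) (hv : ∀ i, v i ≠ 0)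
    (w : Fin n → F)
    (hw : ∀ i, w i = ∏ j ∈ Finset.univ.erase i, (a i - a j)⁻¹)
    (f : Polynomial F) (hf : f.degree < (k : WithBot ℕ)) :
    (∀ c ∈ {c : Fin n → F | ∃ h : Polynomial F,
        h.degree < (k : WithBot ℕ) ∧ c = fun i => v i * h.eval (a i)},
      ∑ i, (v i * f.eval (a i)) * (c i) ^ q = 0) ↔
    ∃ g : Polynomial F, g.degree < ((n - k : ℕ) : WithBot ℕ) ∧
      ∀ i, (v i) ^ (q + 1) * (f.eval (a i)) ^ q = w i * g.eval (a i) := by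
  have hchar : CharP F p := by
    obtain ⟨c, hc⟩ := CharP.exists F
    obtain ⟨m, hcp, hm⟩ := FiniteField.card F c
    have hdvd : c ∣ p := by
      refine hcp.dvd_of_dvd_pow (n := e * 2) ?_
      rw [pow_mul, ← hq, ← hF, hm]
      exact dvd_pow_self c m.ne_zero
    rwa [(Nat.prime_dvd_prime_iff_eq hcp hp).1 hdvd] at hc
  have : Fact p.Prime := ⟨hp⟩
  have hfrob (x : F) : (x ^ q) ^ q = x := by
    rw [← pow_mul, ← sq, ← hF, FiniteField.pow_card]
  have hq0 : q ≠ 0 := hq ▸ pow_ne_zero e hp.ne_zero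
  have hsum (h : Polynomial F) :
      (∑ i, v i * f.eval (a i) * (v i * h.eval (a i)) ^ q) ^ q =
        ∑ i, v i ^ (q + 1) * f.eval (a i) ^ q * h.eval (a i) := by
    rw [hq, sum_pow_char_pow, ← hq]
    refine Finset.sum_congr rfl fun i _ => ?_
    rw [mul_pow, hfrob]
    ring
  rw [← forall_sum_mul_eval_eq_zero_iff hk1 hkn ha hw]
  constructor
  · intro H h hh
    rw [← hsum, H _ ⟨h, hh, rfl⟩, zero_pow hq0]
  · rintro H c ⟨h, hh, rfl⟩
    exact (pow_eq_zero_iff hq0).1 ((hsum h).trans (H h hh))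
end

section
/- Let q be a prime power, let a₁, …, aₙ be n distinct elements of F_{q²}, let v₁, …, vₙ be nonzero elements of F_{q²}, and let wᵢ = ∏_{1 ≤ j ≤ n, j ≠ i} (aᵢ − aⱼ)^{−1}. A codeword c = (v₁ f(a₁), …, vₙ f(aₙ), f_{k−1}) of GRS_k(a, v, ∞) (with deg f ≤ k − 1 and f_{k−1} the coefficient of x^{k−1} in f) lies in the Hermitian dual GRS_k(a, v, ∞)^{⊥_H} if and only if there exists a polynomial g(x) ∈ F_{q²}[x] with deg g(x) ≤ n − k such that (v₁^{q+1} f(a₁)^q, …, vₙ^{q+1} f(aₙ)^q, f_{k−1}^q) = (w₁ g(a₁), …, wₙ g(aₙ), −g_{n−k}), where g_{n−k} is the coefficient of x^{n−k} in g. -/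
open Polynomial in
/-- Summing the values of a polynomial of degree less than the number of nodes against the nodal
weights gives its top coefficient. -/
theorem Lagrange.sum_nodalWeight_mul_eval {F ι : Type*} [Field F] [DecidableEq ι]
    {s : Finset ι} {a : ι → F} (ha : Set.InjOn a s) {P : F[X]} (hP : P.degree < s.card) :
    ∑ i ∈ s, Lagrange.nodalWeight s a i * P.eval (a i) = P.coeff (s.card - 1) := by
  rw [Lagrange.coeff_eq_sum ha hP]
  refine Finset.sum_congr rfl fun i _ => ?_
  rw [Lagrange.nodalWeight, Finset.prod_inv_distrib, div_eq_mul_inv, mul_comm]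

open Polynomial in
/-- The Euclidean dual of an extended generalized Reed–Solomon code. -/
theorem Lagrange.forall_sum_eval_add_coeff_eq_zero_iff {F ι : Type*} [Field F] [DecidableEq ι]
    {s : Finset ι} {a : ι → F} (ha : Set.InjOn a s) {k : ℕ} (hk : 1 ≤ k) (hks : k ≤ s.card)
    (y : ι → F) (z : F) :
    (∀ h : F[X], h.degree < (k : WithBot ℕ) →
      ∑ i ∈ s, y i * h.eval (a i) + z * h.coeff (k - 1) = 0) ↔
    ∃ g : F[X], g.degree ≤ ((s.card - k : ℕ) : WithBot ℕ) ∧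
      (∀ i ∈ s, y i = Lagrange.nodalWeight s a i * g.eval (a i)) ∧
      z = -g.coeff (s.card - k) := by
  have key (g h : F[X]) (hgh : (g * h).degree < s.card)
      (hy : ∀ i ∈ s, y i = Lagrange.nodalWeight s a i * g.eval (a i)) :
      ∑ i ∈ s, y i * h.eval (a i) = (g * h).coeff (s.card - 1) := by
    rw [← Lagrange.sum_nodalWeight_mul_eval ha hgh]
    refine Finset.sum_congr rfl fun i hi => ?_
    rw [hy i hi, eval_mul, mul_assoc]
  constructor
  · intro H
    set g := Lagrange.interpolate s a fun i => (Lagrange.nodalWeight s a i)⁻¹ * y i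
    have hgs : g.degree < s.card := Lagrange.degree_interpolate_lt _ ha
    have hy : ∀ i ∈ s, y i = Lagrange.nodalWeight s a i * g.eval (a i) := fun i hi => by
      rw [Lagrange.eval_interpolate_at_node _ ha hi,
        mul_inv_cancel_left₀ (Lagrange.nodalWeight_ne_zero ha hi)]
    have hX (j d : ℕ) (hd : g.degree ≤ d) (hjd : d + j = s.card - 1) (hjk : j < k) :
        g.coeff d + z * (X ^ j : F[X]).coeff (k - 1) = 0 := by
      have hlt : (g * X ^ j).degree < (s.card : WithBot ℕ) := by
        rw [degree_mul, degree_X_pow]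
        calc
          g.degree + (j : WithBot ℕ) ≤ d + j := by gcongr
          _ < s.card := by exact_mod_cast (by lia : d + j < s.card)
      have := H (X ^ j) (by rw [degree_X_pow]; exact_mod_cast hjk)
      rwa [key g _ hlt hy, ← hjd, coeff_mul_X_pow] at this
    have hgd : g.degree ≤ ((s.card - k : ℕ) : WithBot ℕ) := by
      by_contra! hlt
      have hg0 : g ≠ 0 := by rintro h0; simp [h0] at hlt
      rw [degree_eq_natDegree hg0] at hlt hgs
      replace hlt : s.card - k < g.natDegree := by exact_mod_cast hlt
      replace hgs : g.natDegree < s.card := by exact_mod_cast hgs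
      have := hX (s.card - 1 - g.natDegree) g.natDegree degree_le_natDegree (by lia) (by lia)
      rw [coeff_X_pow, if_neg (by lia), mul_zero, add_zero] at this
      exact hg0 (leadingCoeff_eq_zero.mp this)
    refine ⟨g, hgd, hy, ?_⟩
    have := hX (k - 1) (s.card - k) hgd (by lia) (by lia)
    rw [coeff_X_pow_self, mul_one] at this
    exact eq_neg_of_add_eq_zero_right this
  · rintro ⟨g, hg, hy, rfl⟩ h hh
    have hg' : g.natDegree ≤ s.card - k := natDegree_le_of_degree_le hg
    have hh' : h.natDegree ≤ k - 1 :=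
      natDegree_le_iff_coeff_eq_zero.mpr fun N hN =>
        (degree_lt_iff_coeff_zero h k).mp hh N (by lia)
    have hlt : (g * h).degree < (s.card : WithBot ℕ) := by
      refine degree_le_natDegree.trans_lt ?_
      exact_mod_cast (natDegree_mul_le.trans (by gcongr)).trans_lt
        (by lia : s.card - k + (k - 1) < s.card)
    rw [key g h hlt hy, show s.card - 1 = s.card - k + (k - 1) by lia,
      coeff_mul_add_eq_of_natDegree_le hg' hh']
    ring

/-- A codeword `c = (v₁ f(a₁), …, vₙ f(aₙ), f_{k−1})` of `GRS_k(a, v, ∞)`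
lies in the Hermitian dual `GRS_k(a, v, ∞)^{⊥_H}` iff there exists `g` with
`deg g ≤ n − k` such that
`(v₁^{q+1} f(a₁)^q, …, vₙ^{q+1} f(aₙ)^q, f_{k−1}^q) = (w₁ g(a₁), …, wₙ g(aₙ), −g_{n−k})`. -/
theorem stmt_3 (p e q n k : ℕ) (hp : p.Prime) (he : 0 < e) (hq : q = p ^ e)
    (F : Type) [Field F] [Fintype F] [DecidableEq F] (hF : Fintype.card F = q ^ 2)
    (hk1 : 1 ≤ k) (hkn : k ≤ n)
    (a : Fin n → F) (ha : Function.Injective a)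
    (v : Fin n → F) (hv : ∀ i, v i ≠ 0)
    (w : Fin n → F)
    (hw : ∀ i, w i = ∏ j ∈ Finset.univ.erase i, (a i - a j)⁻¹)
    (f : Polynomial F) (hf : f.degree < (k : WithBot ℕ)) :
    (∀ c ∈ {c : Fin (n + 1) → F | ∃ h : Polynomial F,
        h.degree < (k : WithBot ℕ) ∧
        c = Fin.snoc (fun i => v i * h.eval (a i)) (h.coeff (k - 1))},
      ∑ i, ((Fin.snoc (fun i => v i * f.eval (a i)) (f.coeff (k - 1)) : Fin (n + 1) → F) i)
          * (c i) ^ q = 0) ↔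
    ∃ g : Polynomial F, g.degree ≤ ((n - k : ℕ) : WithBot ℕ) ∧
      (∀ i, (v i) ^ (q + 1) * (f.eval (a i)) ^ q = w i * g.eval (a i)) ∧
      (f.coeff (k - 1)) ^ q = -(g.coeff (n - k)) := by
  have := Fact.mk hp
  have : CharP F p := charP_of_card_eq_prime_pow (p := p) (f := e * 2) (by rw [hF, hq, pow_mul])
  have hqq (x : F) : (x ^ q) ^ q = x := by
    rw [← pow_mul, ← sq, ← hF, FiniteField.pow_card]
  have hq0 : q ≠ 0 := by rw [hq]; exact pow_ne_zero _ hp.ne_zero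
  have hadd (x y : F) : (x + y) ^ q = x ^ q + y ^ q := by rw [hq, add_pow_char_pow]
  have hsum (u : Fin n → F) : (∑ i, u i) ^ q = ∑ i, u i ^ q := by rw [hq, sum_pow_char_pow]
  have hw' (i : Fin n) : w i = Lagrange.nodalWeight Finset.univ a i := hw i
  have dual := Lagrange.forall_sum_eval_add_coeff_eq_zero_iff (s := Finset.univ) ha.injOn hk1
    (by simpa using hkn) (fun i => v i ^ (q + 1) * f.eval (a i) ^ q) (f.coeff (k - 1) ^ q)
  simp only [Finset.card_univ, Fintype.card_fin, Finset.mem_univ, forall_const, ← hw'] at dual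
  rw [← dual]
  simp only [Set.mem_ofPred_eq, forall_exists_index, and_imp]
  rw [forall_comm]
  refine forall_congr' fun h => ?_
  rw [forall_comm]
  refine forall_congr' fun _ => ?_
  rw [forall_eq, ← pow_eq_zero_iff hq0, Fin.sum_univ_castSucc, hadd, hsum]
  simp only [Fin.snoc_castSucc, Fin.snoc_last, mul_pow, hqq]
  refine Eq.congr_left (congrArg₂ _ (Finset.sum_congr rfl fun i _ => ?_) rfl)
  ring
end

section
/- Let q be a prime power, fix α ∈ F_{q²} \ F_q, and for β ∈ F_q let F_β = F_q + βα = { x + βα : x ∈ F_q }. Then for any two distinct β, β′ ∈ F_q and any b ∈ F_β, we have ∏_{h ∈ F_{β′}} (b − h) = (β − β′)(α^q − α). -/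
open Polynomial in
/-- Over a field with `q ^ 2` elements, `y ^ q - y` is the product of `y - x` over the elements `x`
fixed by the `q`-power map. -/
theorem prod_sub_filter_pow_eq_self {F : Type*} [Field F] [Fintype F] [DecidableEq F]
    (p e : ℕ) [Fact p.Prime] [CharP F p] (he : 0 < e) (hF : Fintype.card F = (p ^ e) ^ 2) (y : F) :
    ∏ x ∈ Finset.univ.filter (fun x : F => x ^ p ^ e = x), (y - x) = y ^ p ^ e - y := by
  have hq : 1 < p ^ e := Nat.one_lt_pow he.ne' (Fact.out : p.Prime).one_lt
  have hne : (X ^ p ^ e - X : F[X]) ≠ 0 := FiniteField.X_pow_card_sub_X_ne_zero F hq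
  have hdvd : (X ^ p ^ e - X : F[X]) ∣ X ^ Fintype.card F - X := by
    have h : (X ^ Fintype.card F - X : F[X]) = (X ^ p ^ e - X) ^ p ^ e + (X ^ p ^ e - X) := by
      rw [sub_pow_char_pow, ← pow_mul, hF, sq]
      ring
    rw [h]
    exact dvd_add (dvd_pow_self _ (by omega)) dvd_rfl
  have hsplits : (X ^ p ^ e - X : F[X]).Splits := by
    refine Splits.of_dvd ?_ (FiniteField.X_pow_card_sub_X_ne_zero F Fintype.one_lt_card) hdvd
    rw [splits_iff_card_roots, FiniteField.roots_X_pow_card_sub_X,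
      FiniteField.X_pow_card_sub_X_natDegree_eq F Fintype.one_lt_card]
    rfl
  have hmonic : (X ^ p ^ e - X : F[X]).Monic := monic_X_pow_sub (by rw [degree_X]; exact_mod_cast hq)
  have hnodup : (X ^ p ^ e - X : F[X]).roots.Nodup :=
    nodup_roots (galois_poly_separable p _ (dvd_pow_self p he.ne'))
  have hroots : (Finset.univ.filter (fun x : F => x ^ p ^ e = x)).val =
      (X ^ p ^ e - X : F[X]).roots := by
    refine (Multiset.Nodup.ext (Finset.nodup _) hnodup).2 fun x => ?_
    simp [mem_roots hne, sub_eq_zero]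
  have hprod := congrArg (eval y) (hsplits.eq_prod_roots_of_monic hmonic)
  rw [← hroots] at hprod
  change _ = eval y (∏ x ∈ Finset.univ.filter (fun x : F => x ^ p ^ e = x), (X - C x)) at hprod
  simpa [eval_prod] using hprod.symm

/-- For `α ∈ F_{q²} \ F_q`, distinct `β, β′ ∈ F_q`, and `b ∈ F_β`,
`∏_{h ∈ F_{β′}} (b − h) = (β − β′)(α^q − α)`. -/
theorem stmt_6 (p e q : ℕ) (hp : p.Prime) (he : 0 < e) (hq : q = p ^ e)
    (F : Type) [Field F] [Fintype F] [DecidableEq F] (hF : Fintype.card F = q ^ 2)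
    (α : F) (hα : α ^ q ≠ α)
    (β β' : F) (hβ : β ^ q = β) (hβ' : β' ^ q = β') (hne : β ≠ β') (b : F)
    (hb : b ∈ (Finset.univ.filter (fun x : F => x ^ q = x)).image (fun x => x + β * α)) :
    ∏ h ∈ (Finset.univ.filter (fun x : F => x ^ q = x)).image (fun x => x + β' * α),
        (b - h) = (β - β') * (α ^ q - α) := by
  subst hq
  have := Fact.mk hp
  have : CharP F p := by
    rw [CharP.charP_iff_prime_eq_zero hp]
    have h := FiniteField.cast_card_eq_zero F
    rw [hF] at h
    push_cast at h
    exact eq_zero_of_pow_eq_zero (eq_zero_of_pow_eq_zero h)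
  obtain ⟨a, ha, rfl⟩ := Finset.mem_image.1 hb
  replace ha := (Finset.mem_filter.1 ha).2
  rw [Finset.prod_image (add_left_injective _).injOn]
  have h := prod_sub_filter_pow_eq_self p e he hF (a + (β - β') * α)
  rw [add_pow_char_pow, mul_pow, sub_pow_char_pow, ha, hβ, hβ'] at h
  calc _ = ∏ x ∈ Finset.univ.filter (fun x : F => x ^ p ^ e = x), (a + (β - β') * α - x) :=
        Finset.prod_congr rfl fun x _ => by ring
    _ = _ := by rw [h]; ring
end

section
/- Let q be a prime power, fix α ∈ F_{q²} \ F_q, label the elements of F_q as β₁, …, β_q, and let F_i = F_q + β_i α. Let 1 ≤ t ≤ q, n = tq, X = F₁ ∪ ⋯ ∪ F_t, and label the elements of X as a₁, …, aₙ. If aᵢ ∈ F_s for some 1 ≤ s ≤ t, then ∏_{1 ≤ j ≤ n, j ≠ i} (aᵢ − aⱼ) = (−1)^q (α^q − α)^{t−1} ∏_{1 ≤ j ≤ t, j ≠ s} (β_s − β_j). -/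
open Polynomial in
/-- A family of `q` distinct solutions of `y ^ q = y` exhausts the roots of `X ^ q - X`. -/
theorem nodal_eq_X_pow_sub_X {F : Type*} [Field F] {q : ℕ} (hq : 1 < q) (β : Fin q → F)
    (hβq : ∀ i, β i ^ q = β i) (hβinj : Function.Injective β) :
    Lagrange.nodal Finset.univ β = X ^ q - X := by
  have hdeg : (X ^ q - X : F[X]).degree = q := by
    rw [degree_sub_eq_left_of_degree_lt] <;> simp [hq]
  have hmonic : (X ^ q - X : F[X]).Monic := by
    apply monic_X_pow_sub
    simp only [degree_X]
    exact_mod_cast hq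
  refine eq_of_degree_sub_lt_of_eval_index_eq (s := Finset.univ) (v := β) hβinj.injOn ?_ ?_
  · refine (degree_sub_lt_left ?_ Lagrange.nodal_ne_zero ?_).trans_eq ?_
    · rw [Lagrange.degree_nodal, hdeg]; simp
    · rw [Lagrange.nodal_monic.leadingCoeff, hmonic.leadingCoeff]
    · rw [Lagrange.degree_nodal]
  · intro i hi
    rw [Lagrange.eval_nodal_at_node hi]
    simp [hβq]


/-- With `β₁, …, β_q` enumerating `F_q`, `F_i = F_q + β_i α`,
`1 ≤ t ≤ q`, `n = tq`, and `a₁, …, aₙ` enumerating `X = F₁ ∪ ⋯ ∪ F_t`: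
if `aᵢ ∈ F_s` for some `1 ≤ s ≤ t`, then
`∏_{j ≠ i} (aᵢ − aⱼ) = (−1)^q (α^q − α)^{t−1} ∏_{j ≤ t, j ≠ s} (β_s − β_j)`. -/
theorem stmt_7 (p e q t : ℕ) (hp : p.Prime) (he : 0 < e) (hq : q = p ^ e)
    (F : Type) [Field F] [Fintype F] [DecidableEq F] (hF : Fintype.card F = q ^ 2)
    (α : F) (hα : α ^ q ≠ α)
    (β : Fin q → F) (hβq : ∀ i, (β i) ^ q = β i) (hβinj : Function.Injective β)
    (ht1 : 1 ≤ t) (htq : t ≤ q)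
    (a : Fin (t * q) → F) (hainj : Function.Injective a)
    (hrange : ∀ x : F, (∃ j, a j = x) ↔
        ∃ s : Fin q, s.val < t ∧
          x ∈ (Finset.univ.filter (fun y : F => y ^ q = y)).image (fun y => y + β s * α))
    (i : Fin (t * q)) (s : Fin q) (hs : s.val < t)
    (hi : a i ∈ (Finset.univ.filter (fun y : F => y ^ q = y)).image (fun y => y + β s * α)) :
    ∏ j ∈ Finset.univ.erase i, (a i - a j) =
      (-1) ^ q * (α ^ q - α) ^ (t - 1) *
        ∏ s' ∈ Finset.univ.filter (fun s' : Fin q => s'.val < t ∧ s' ≠ s), (β s - β s') := by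
  subst hq
  have := Fact.mk hp
  have hq1 : 1 < p ^ e := Nat.one_lt_pow he.ne' hp.one_lt
  have hchar : CharP F p := by
    obtain ⟨r, hr⟩ := CharP.exists F
    have hrp : r.Prime := CharP.char_is_prime F r
    have := Fact.mk hrp
    obtain ⟨n, -, hn⟩ := FiniteField.card F r
    rw [hF, ← pow_mul] at hn
    have : p = r := by
      have hd : p ∣ r ^ (n : ℕ) := hn ▸ dvd_pow_self p (by positivity)
      exact (Nat.prime_dvd_prime_iff_eq hp hrp).1 (hp.dvd_of_dvd_pow hd)
    exact this ▸ hr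
  have hnodal := nodal_eq_X_pow_sub_X hq1 β hβq hβinj
  have hprod (x : F) : ∏ m, (x - β m) = x ^ p ^ e - x := by
    rw [← Lagrange.eval_nodal, hnodal]; simp
  have hmem (y : F) : y ^ p ^ e = y ↔ ∃ m, β m = y := by
    rw [← sub_eq_zero, ← hprod, Finset.prod_eq_zero_iff]
    simp [sub_eq_zero, eq_comm]
  have hderiv (m : Fin (p ^ e)) : ∏ m' ∈ Finset.univ.erase m, (β m - β m') = -1 := by
    rw [← Lagrange.eval_nodal,
      ← Lagrange.eval_nodal_derivative_eval_node_eq (Finset.mem_univ m), hnodal]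
    simp [Polynomial.derivative_X_pow, he.ne']
  have hneg : (-1 : F) ^ p ^ e = -1 := by
    rcases hp.eq_two_or_odd' with rfl | hodd
    · rw [CharTwo.neg_eq]; simp
    · exact (hodd.pow).neg_one_pow
  set T : Finset (Fin (p ^ e)) := Finset.univ.filter (fun s' => s'.val < t) with hT
  have hTcard : T.card = t := by
    rw [hT, Fin.card_filter_val_lt, min_eq_right htq]
  have hsT : s ∈ T := by simp [hT, hs]
  let f : Fin (p ^ e) × Fin (p ^ e) → F := fun z => β z.1 + β z.2 * α
  have hsub (u v : F) : (u - v) ^ p ^ e = u ^ p ^ e - v ^ p ^ e := sub_pow_char_pow u v e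
  have hadd (u v : F) : (u + v) ^ p ^ e = u ^ p ^ e + v ^ p ^ e := add_pow_char_pow u v p e
  have hf : Function.Injective f := by
    rintro ⟨m, r⟩ ⟨m', r'⟩ h
    have h1 : β m + β r * α = β m' + β r' * α := h
    have h2 := congrArg (· ^ p ^ e) h1
    simp only [hadd, mul_pow, hβq] at h2
    have h3 : (β r - β r') * (α ^ p ^ e - α) = 0 := by linear_combination h2 - h1
    have h4 : β r = β r' :=
      sub_eq_zero.1 ((mul_eq_zero.1 h3).resolve_right (sub_ne_zero.2 hα))
    have h5 : β m = β m' := by rw [h4] at h1; exact add_right_cancel h1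
    rw [hβinj h4, hβinj h5]
  have himage : Finset.univ.image a = (Finset.univ ×ˢ T).image f := by
    ext x
    simp only [Finset.mem_image, Finset.mem_univ, true_and, hrange, Finset.mem_filter, hmem,
      Finset.mem_product, Prod.exists, hT, f]
    constructor
    · rintro ⟨r, hr, _, ⟨m, rfl⟩, rfl⟩
      exact ⟨m, r, hr, rfl⟩
    · rintro ⟨m, r, hr, rfl⟩
      exact ⟨r, hr, _, ⟨m, rfl⟩, rfl⟩
  obtain ⟨m, hm⟩ : ∃ m, f (m, s) = a i := by
    simp only [Finset.mem_image, Finset.mem_filter, Finset.mem_univ, true_and, hmem] at hi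
    obtain ⟨_, ⟨m, rfl⟩, h⟩ := hi
    exact ⟨m, h⟩
  have hsplit : (Finset.univ ×ˢ T).erase (m, s) =
      (Finset.univ ×ˢ T.erase s) ∪ (Finset.univ.erase m ×ˢ {s}) := by
    ext ⟨m', r⟩
    by_cases hr : r = s
    · simp [hr, hsT]
    · simp [hr, Ne.symm hr]
  have hdisj : Disjoint ((Finset.univ : Finset (Fin (p ^ e))) ×ˢ T.erase s)
      (Finset.univ.erase m ×ˢ {s}) := by
    rw [Finset.disjoint_left]
    rintro ⟨m', r⟩ h h'
    simp_all
  have hcoset (r : Fin (p ^ e)) :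
      ∏ m', (f (m, s) - f (m', r)) = (α ^ p ^ e - α) * (β s - β r) := by
    have h := hprod (β m + (β s - β r) * α)
    simp only [hadd, mul_pow, hsub, hβq] at h
    rw [show (α ^ p ^ e - α) * (β s - β r) =
      β m + (β s - β r) * α ^ p ^ e - (β m + (β s - β r) * α) by ring, ← h]
    exact Finset.prod_congr rfl fun m' _ => by simp only [f]; ring
  have hfilter : Finset.univ.filter (fun s' : Fin (p ^ e) => s'.val < t ∧ s' ≠ s) =
      T.erase s := by
    ext r; simp [hT, and_comm]
  calc ∏ j ∈ Finset.univ.erase i, (a i - a j)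
      = ∏ x ∈ (Finset.univ.image a).erase (a i), (a i - x) := by
        rw [← Finset.image_erase hainj, Finset.prod_image hainj.injOn]
    _ = ∏ z ∈ (Finset.univ ×ˢ T).erase (m, s), (f (m, s) - f z) := by
        rw [himage, ← hm, ← Finset.image_erase hf, Finset.prod_image hf.injOn]
    _ = (∏ r ∈ T.erase s, ∏ m', (f (m, s) - f (m', r))) *
          ∏ m' ∈ Finset.univ.erase m, (β m - β m') := by
        rw [hsplit, Finset.prod_union hdisj, Finset.prod_product_right, Finset.prod_product]
        simp [f]
    _ = _ := by
        simp only [hcoset, hderiv, hneg, hfilter, Finset.prod_mul_distrib, Finset.prod_const,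
          Finset.card_erase_of_mem hsT, hTcard]
        ring
end

section
/- Let q be a prime power, fix α ∈ F_{q²} \ F_q, label the elements of F_q as β₁, …, β_q, let F_i = F_q + β_i α, let 1 ≤ t ≤ q, n = tq, and let a₁, …, aₙ enumerate X = F₁ ∪ ⋯ ∪ F_t. For each i, setting wᵢ = ∏_{1 ≤ j ≤ n, j ≠ i} (aᵢ − aⱼ)^{−1}, the element wᵢ (α^q − α)^{t−1} is a nonzero element of the subfield F_q. -/
/-- A field of cardinality a power of `q = p ^ e` has a `q`-power Frobenius ring homomorphism. -/
theorem exists_ringHom_eq_pow {p e q : ℕ} (hp : p.Prime) (hq : q = p ^ e)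
    {F : Type*} [Field F] [Fintype F] {m : ℕ} (hF : Fintype.card F = q ^ m) :
    ∃ φ : F →+* F, ∀ x, φ x = x ^ q := by
  have : Fact p.Prime := ⟨hp⟩
  have : CharP F p := charP_of_card_eq_prime_pow (f := e * m) (by rw [hF, hq, pow_mul])
  exact ⟨iterateFrobenius F p e, fun x => by rw [iterateFrobenius_def, hq]⟩

open Polynomial in
/-- If `β` enumerates `q` distinct roots of `X ^ q - X`, then `∏ (z - β r) = z ^ q - z`. -/
theorem prod_sub_eq_pow_sub_self {F : Type*} [Field F] {q : ℕ} (hq : 1 < q) {β : Fin q → F}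
    (hβq : ∀ r, β r ^ q = β r) (hβ : Function.Injective β) (z : F) :
    ∏ r, (z - β r) = z ^ q - z := by
  have hmonic : (X ^ q - X : F[X]).Monic :=
    monic_X_pow_sub (by rw [degree_X]; exact_mod_cast hq)
  have hdeg : (X ^ q - X : F[X]).degree = q := by
    rw [degree_sub_eq_left_of_degree_lt] <;> rw [degree_X_pow]
    rw [degree_X]
    exact_mod_cast hq
  have hdeg' : (∏ r, (X - C (β r)) : F[X]).degree = q := by
    simp [degree_prod]
  have key : (∏ r, (X - C (β r)) : F[X]) = X ^ q - X := by
    refine eq_of_degree_sub_lt_of_eval_index_eq Finset.univ (v := β) hβ.injOn ?_ ?_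
    · rw [Finset.card_univ, Fintype.card_fin]
      refine (degree_sub_lt_left (hdeg'.trans hdeg.symm) ?_ ?_).trans_eq hdeg'
      · exact (monic_prod_of_monic _ _ fun r _ => monic_X_sub_C _).ne_zero
      · rw [hmonic.leadingCoeff, (monic_prod_of_monic _ _ fun r _ => monic_X_sub_C _).leadingCoeff]
    · intro r _
      rw [eval_prod, Finset.prod_eq_zero (Finset.mem_univ r) (by simp)]
      simp [hβq]
  simpa [eval_prod] using congrArg (eval z) key

/-- In the setting of Statement 7, for each `i`, with
`wᵢ = ∏_{j ≠ i} (aᵢ − aⱼ)⁻¹`, the element `wᵢ (α^q − α)^{t−1}` is a nonzero element of the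
subfield `F_q` (i.e. it is nonzero and fixed by the `q`-power map). -/
theorem stmt_8 (p e q t : ℕ) (hp : p.Prime) (he : 0 < e) (hq : q = p ^ e)
    (F : Type) [Field F] [Fintype F] [DecidableEq F] (hF : Fintype.card F = q ^ 2)
    (α : F) (hα : α ^ q ≠ α)
    (β : Fin q → F) (hβq : ∀ i, (β i) ^ q = β i) (hβinj : Function.Injective β)
    (ht1 : 1 ≤ t) (htq : t ≤ q)
    (a : Fin (t * q) → F) (hainj : Function.Injective a)
    (hrange : ∀ x : F, (∃ j, a j = x) ↔
        ∃ s : Fin q, s.val < t ∧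
          x ∈ (Finset.univ.filter (fun y : F => y ^ q = y)).image (fun y => y + β s * α))
    (w : Fin (t * q) → F)
    (hw : ∀ i, w i = ∏ j ∈ Finset.univ.erase i, (a i - a j)⁻¹)
    (i : Fin (t * q)) :
    w i * (α ^ q - α) ^ (t - 1) ≠ 0 ∧
      (w i * (α ^ q - α) ^ (t - 1)) ^ q = w i * (α ^ q - α) ^ (t - 1) := by
  obtain ⟨φ, hφ⟩ := exists_ringHom_eq_pow hp hq hF
  have hq1 : 1 < q := hq ▸ Nat.one_lt_pow he.ne' hp.one_lt
  have hδ : α ^ q - α ≠ 0 := sub_ne_zero.mpr hα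
  have hφβ : ∀ r, φ (β r) = β r := fun r => (hφ _).trans (hβq r)
  have hfix : ∀ y : F, y ^ q = y → ∃ r, β r = y := by
    intro y hy
    have h := prod_sub_eq_pow_sub_self hq1 hβq hβinj y
    rw [hy, sub_self, Finset.prod_eq_zero_iff] at h
    obtain ⟨r, -, hr⟩ := h
    exact ⟨r, (sub_eq_zero.mp hr).symm⟩
  have hrange' : ∀ x : F, (∃ j, a j = x) ↔ ∃ r s : Fin q, s.val < t ∧ β r + β s * α = x := by
    intro x
    rw [hrange]
    constructor
    · rintro ⟨s, hs, hx⟩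
      simp only [Finset.mem_image, Finset.mem_filter, Finset.mem_univ, true_and] at hx
      obtain ⟨y, hy, rfl⟩ := hx
      obtain ⟨r, rfl⟩ := hfix y hy
      exact ⟨r, s, hs, rfl⟩
    · rintro ⟨r, s, hs, rfl⟩
      exact ⟨s, hs, Finset.mem_image_of_mem _ (by simp [hβq])⟩
  have hpair : ∀ r s r' s' : Fin q, β r + β s * α = β r' + β s' * α → r = r' ∧ s = s' := by
    intro r s r' s' h
    have h' := congrArg φ h
    simp only [map_add, map_mul, hφβ, hφ α] at h'
    have hs : s = s' := by
      apply hβinj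
      apply mul_right_cancel₀ hδ
      linear_combination h' - h
    subst hs
    exact ⟨hβinj (add_right_cancel h), rfl⟩
  obtain ⟨r₀, s₀, hs₀, hi⟩ := (hrange' (a i)).mp ⟨i, rfl⟩
  set S : Finset (Fin q) := Finset.univ.filter fun s => s.val < t with hS
  have hScard : S.card = t := by
    rw [hS, Fin.card_filter_val_lt, min_eq_right htq]
  let g : F → F := fun x => if x = a i then 1 else a i - x
  have hP : ∏ j ∈ Finset.univ.erase i, (a i - a j) = ∏ s ∈ S, ∏ r, g (β r + β s * α) := by
    calc ∏ j ∈ Finset.univ.erase i, (a i - a j)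
        = ∏ j ∈ Finset.univ.erase i, g (a j) := by
          refine Finset.prod_congr rfl fun j hj => ?_
          exact (if_neg fun h => (Finset.mem_erase.mp hj).1 (hainj h)).symm
      _ = ∏ j, g (a j) := Finset.prod_erase _ (if_pos rfl)
      _ = ∏ x ∈ Finset.univ.image a, g x := (Finset.prod_image hainj.injOn).symm
      _ = ∏ x ∈ (S ×ˢ Finset.univ).image fun u : Fin q × Fin q => β u.2 + β u.1 * α, g x := by
          refine Finset.prod_congr ?_ fun _ _ => rfl
          ext x
          simp only [Finset.mem_image, Finset.mem_univ, true_and, hrange', Finset.mem_product,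
            and_true, Prod.exists, hS, Finset.mem_filter]
          exact ⟨fun ⟨r, s, h⟩ => ⟨s, r, h⟩, fun ⟨s, r, h⟩ => ⟨r, s, h⟩⟩
      _ = ∏ s ∈ S, ∏ r, g (β r + β s * α) := by
          rw [Finset.prod_image, Finset.prod_product]
          rintro ⟨s, r⟩ - ⟨s', r'⟩ - h
          obtain ⟨rfl, rfl⟩ := hpair _ _ _ _ h
          rfl
  have hother : ∀ s ∈ S.erase s₀,
      ∏ r, g (β r + β s * α) = (β s₀ - β s) * (α ^ q - α) := by
    intro s hs
    have hne : s ≠ s₀ := (Finset.mem_erase.mp hs).1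
    calc ∏ r, g (β r + β s * α)
        = ∏ r, (β r₀ + (β s₀ - β s) * α - β r) := by
          refine Finset.prod_congr rfl fun r _ => ?_
          rw [show g (β r + β s * α) = a i - (β r + β s * α) from
            if_neg fun h => hne (hpair _ _ _ _ (h.trans hi.symm)).2, ← hi]
          ring
      _ = (β s₀ - β s) * (α ^ q - α) := by
          rw [prod_sub_eq_pow_sub_self hq1 hβq hβinj, ← hφ]
          simp only [map_add, map_sub, map_mul, hφβ, hφ α]
          ring
  have hsame : φ (∏ r, g (β r + β s₀ * α)) = ∏ r, g (β r + β s₀ * α) := by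
    rw [map_prod]
    refine Finset.prod_congr rfl fun r _ => ?_
    simp only [g, ← hi]
    split_ifs with h
    · exact map_one φ
    · rw [add_sub_add_right_eq_sub, map_sub, hφβ, hφβ]
  have hs₀S : s₀ ∈ S := by simp [hS, hs₀]
  have hPne : ∏ j ∈ Finset.univ.erase i, (a i - a j) ≠ 0 :=
    Finset.prod_ne_zero_iff.mpr fun j hj =>
      sub_ne_zero.mpr fun h => (Finset.mem_erase.mp hj).1 (hainj h.symm)
  have hfactor : ∏ j ∈ Finset.univ.erase i, (a i - a j) =
      (∏ r, g (β r + β s₀ * α)) * (∏ s ∈ S.erase s₀, (β s₀ - β s)) * (α ^ q - α) ^ (t - 1) := by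
    rw [hP, ← Finset.mul_prod_erase S _ hs₀S, Finset.prod_congr rfl hother,
      Finset.prod_mul_distrib, Finset.prod_const, Finset.card_erase_of_mem hs₀S, hScard, mul_assoc]
  rw [hw, Finset.prod_inv_distrib]
  refine ⟨mul_ne_zero (inv_ne_zero hPne) (pow_ne_zero _ hδ), ?_⟩
  rw [hfactor, mul_inv, inv_mul_cancel_right₀ (pow_ne_zero _ hδ), ← hφ, map_inv₀, map_mul, hsame,
    map_prod]
  simp only [map_sub, hφβ]
end

section
/- Let q be a prime power, fix α ∈ F_{q²} \ F_q, label the elements of F_q as β₁, …, β_q, let F_i = F_q + β_i α, let 1 ≤ t ≤ q, n = tq, and let a₁, …, aₙ enumerate X = F₁ ∪ ⋯ ∪ F_t. Set wᵢ = ∏_{j ≠ i} (aᵢ − aⱼ)^{−1} and choose vᵢ ∈ F_{q²}^* with vᵢ^{q+1} = wᵢ (α^q − α)^{t−1} (such vᵢ exist). Then for every k with 1 ≤ k ≤ ⌊(tq + q − 1)/(q + 1)⌋, the code GRS_k(a, v) is contained in its Hermitian dual: GRS_k(a, v) ⊆ GRS_k(a, v)^{⊥_H}. -/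
/-- Divided-difference identity: the nodal weights annihilate every polynomial of degree less than
`#s - 1`. -/
theorem Lagrange.sum_nodalWeight_mul_eval_eq_zero {F ι : Type*} [Field F] [DecidableEq ι]
    {s : Finset ι} {x : ι → F} (hx : Set.InjOn x s) {P : Polynomial F}
    (hP : P.natDegree + 1 < s.card) :
    ∑ i ∈ s, Lagrange.nodalWeight s x i * P.eval (x i) = 0 := by
  have hdeg : P.degree < s.card :=
    P.degree_le_natDegree.trans_lt (by exact_mod_cast (by omega : P.natDegree < s.card))
  have hcoeff := Lagrange.coeff_eq_sum hx hdeg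
  rw [Polynomial.coeff_eq_zero_of_natDegree_lt (by omega)] at hcoeff
  rw [hcoeff]
  refine Finset.sum_congr rfl fun i _ => ?_
  rw [Lagrange.nodalWeight, Finset.prod_inv_distrib, div_eq_mul_inv, mul_comm]

/-- In the setting of Statement 7, choose `vᵢ ∈ F_{q²}^*` with
`vᵢ^{q+1} = wᵢ (α^q − α)^{t−1}`.  Then for every `k` with
`1 ≤ k ≤ ⌊(tq + q − 1)/(q + 1)⌋`, the code `GRS_k(a, v)` is contained in its Hermitian
dual. -/
theorem stmt_9 (p e q t k : ℕ) (hp : p.Prime) (he : 0 < e) (hq : q = p ^ e)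
    (F : Type) [Field F] [Fintype F] [DecidableEq F] (hF : Fintype.card F = q ^ 2)
    (α : F) (hα : α ^ q ≠ α)
    (β : Fin q → F) (hβq : ∀ i, (β i) ^ q = β i) (hβinj : Function.Injective β)
    (ht1 : 1 ≤ t) (htq : t ≤ q)
    (a : Fin (t * q) → F) (hainj : Function.Injective a)
    (hrange : ∀ x : F, (∃ j, a j = x) ↔
        ∃ s : Fin q, s.val < t ∧
          x ∈ (Finset.univ.filter (fun y : F => y ^ q = y)).image (fun y => y + β s * α))
    (w : Fin (t * q) → F)
    (hw : ∀ i, w i = ∏ j ∈ Finset.univ.erase i, (a i - a j)⁻¹)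
    (v : Fin (t * q) → F) (hv0 : ∀ i, v i ≠ 0)
    (hv : ∀ i, (v i) ^ (q + 1) = w i * (α ^ q - α) ^ (t - 1))
    (hk1 : 1 ≤ k) (hk : k ≤ (t * q + q - 1) / (q + 1)) :
    ∀ u ∈ {c : Fin (t * q) → F | ∃ f : Polynomial F,
        f.degree < (k : WithBot ℕ) ∧ c = fun i => v i * f.eval (a i)},
      ∀ c ∈ {c : Fin (t * q) → F | ∃ f : Polynomial F,
        f.degree < (k : WithBot ℕ) ∧ c = fun i => v i * f.eval (a i)},
      ∑ i, u i * (c i) ^ q = 0 := by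
  rintro _ ⟨f, hf, rfl⟩ _ ⟨g, hg, rfl⟩
  have natDegree_lt {h : Polynomial F} (hh : h.degree < (k : WithBot ℕ)) : h.natDegree < k := by
    rcases eq_or_ne h 0 with rfl | h0
    · rwa [Polynomial.natDegree_zero]
    · exact (Polynomial.natDegree_lt_iff_degree_lt h0).2 hh
  have hq2 : 2 ≤ q := hq ▸ hp.two_le.trans (Nat.le_self_pow he.ne' p)
  have hnat : (f * g ^ q).natDegree + 1 < (Finset.univ : Finset (Fin (t * q))).card := by
    have hmul : (f * g ^ q).natDegree ≤ f.natDegree + q * g.natDegree :=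
      Polynomial.natDegree_mul_le.trans (Nat.add_le_add_left Polynomial.natDegree_pow_le _)
    have hk' : k * (q + 1) ≤ t * q + q - 1 := (Nat.le_div_iff_mul_le (by omega)).1 hk
    obtain ⟨m, rfl⟩ : ∃ m, k = m + 1 := ⟨k - 1, by omega⟩
    have hf' : f.natDegree ≤ m := Nat.le_of_lt_succ (natDegree_lt hf)
    have hg' : q * g.natDegree ≤ q * m :=
      Nat.mul_le_mul_left q (Nat.le_of_lt_succ (natDegree_lt hg))
    rw [Finset.card_fin]
    have hexp : (m + 1) * (q + 1) = q * m + m + q + 1 := by ring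
    omega
  calc ∑ i, v i * f.eval (a i) * (v i * g.eval (a i)) ^ q
      = (α ^ q - α) ^ (t - 1) *
          ∑ i, Lagrange.nodalWeight Finset.univ a i * (f * g ^ q).eval (a i) := by
        rw [Finset.mul_sum]
        refine Finset.sum_congr rfl fun i _ => ?_
        have hvi : v i ^ (q + 1) =
            Lagrange.nodalWeight Finset.univ a i * (α ^ q - α) ^ (t - 1) := by
          rw [hv, hw, Lagrange.nodalWeight]
        rw [Polynomial.eval_mul, Polynomial.eval_pow]
        linear_combination f.eval (a i) * g.eval (a i) ^ q * hvi
    _ = 0 := by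
        rw [Lagrange.sum_nodalWeight_mul_eval_eq_zero hainj.injOn hnat, mul_zero]
end

section
/- Let q be a prime power, let 1 ≤ t ≤ q, and let 1 ≤ k ≤ ⌊(tq + q − 1)/(q + 1)⌋. Then there exists a linear code C over F_{q²} of length tq, dimension k, and minimum Hamming distance tq − k + 1 (i.e., a [tq, k, tq − k + 1] MDS code) such that C ⊆ C^{⊥_H}, i.e., C is Hermitian self-orthogonal. -/
open Polynomial

theorem FiniteField.X_pow_card_sub_X_eq_prod (K : Type*) [Field K] [Fintype K] :
    (X ^ Fintype.card K - X : K[X]) = ∏ c : K, (X - C c) := by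
  have hdeg := FiniteField.X_pow_card_sub_X_natDegree_eq K (Fintype.one_lt_card (α := K))
  have hroots := FiniteField.roots_X_pow_card_sub_X K
  have hmonic : (X ^ Fintype.card K - X : K[X]).Monic :=
    monic_X_pow_sub (by simpa using Fintype.one_lt_card (α := K))
  have h := prod_multiset_X_sub_C_of_monic_of_roots_card_eq hmonic
    (by rw [hroots, hdeg]; simp)
  rw [hroots] at h
  exact h.symm

theorem FiniteField.prod_sub_algebraMap (K : Type*) {F : Type*} [Field K] [Fintype K] [Field F]
    [Algebra K F] (y : F) :
    ∏ c : K, (y - algebraMap K F c) = y ^ Fintype.card K - y := by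
  simpa [map_prod] using (congrArg (aeval y) (FiniteField.X_pow_card_sub_X_eq_prod K)).symm

/-- A finite field with `(p ^ e) ^ 2` elements contains the field with `p ^ e` elements. -/
theorem FiniteField.exists_algebra_galoisField {p e : ℕ} [Fact p.Prime] (he : 0 < e)
    {F : Type} [Field F] [Fintype F] (hF : Fintype.card F = (p ^ e) ^ 2) :
    Nonempty (Algebra (GaloisField p e) F) := by
  have : CharP F p := by
    have := Fact.out (p := p.Prime)
    obtain ⟨r, hr, n, hprime, hcard⟩ := FiniteField.card' F
    have hpr : p ∣ r := by
      refine this.dvd_of_dvd_pow (n := (n : ℕ)) ?_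
      rw [← hcard, hF]
      exact (dvd_pow_self p he.ne').trans (dvd_pow_self _ two_ne_zero)
    rwa [(Nat.prime_dvd_prime_iff_eq this hprime).1 hpr]
  let := ZMod.algebra F p
  have hfin : Module.finrank (ZMod p) F = e * 2 := by
    have h := FiniteField.pow_finrank_eq_card p F
    rw [hF, ← pow_mul] at h
    exact Nat.pow_right_injective (Fact.out (p := p.Prime)).two_le h
  obtain ⟨f⟩ := FiniteField.nonempty_algHom_of_finrank_dvd (F := ZMod p) (K := GaloisField p e)
    (L := F) (by rw [hfin, GaloisField.finrank p he.ne']; exact dvd_mul_right _ _)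
  exact ⟨f.toRingHom.toAlgebra⟩

/-- Elements of the subfield of index two are norms, i.e. `(q + 1)`-st powers. -/
theorem FiniteField.exists_pow_card_add_one_eq {K F : Type*} [Field K] [Fintype K] [Field F]
    [Fintype F] [Algebra K F] (hF : Fintype.card F = Fintype.card K ^ 2) (x : K) :
    ∃ v : F, v ^ (Fintype.card K + 1) = algebraMap K F x := by
  obtain ⟨v, rfl⟩ := FiniteField.norm_surjective K F x
  refine ⟨v, ?_⟩
  have h1 := Fintype.one_lt_card (α := K)
  rw [FiniteField.algebraMap_norm_eq_pow]
  congr 1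
  rw [Nat.card_eq_fintype_card, Nat.card_eq_fintype_card, hF]
  symm
  apply Nat.div_eq_of_eq_mul_left (by omega)
  simpa using Nat.sq_sub_sq (Fintype.card K) 1

/-- The points `s j * β + c`, with the `s j` distinct elements of `K`, `c ∈ K` and `β ∉ K`. -/
def cosetPoint {K F τ : Type*} [Field K] [Field F] [Algebra K F] (β : F) (s : τ → K)
    (i : τ × K) : F :=
  algebraMap K F (s i.1) * β + algebraMap K F i.2

theorem cosetPoint_injective {K F τ : Type*} [Field K] [Field F] [Algebra K F] {β : F}
    (hβ : β ∉ Set.range (algebraMap K F)) {s : τ → K} (hs : Function.Injective s) :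
    Function.Injective (cosetPoint (F := F) β s) := by
  rintro ⟨j, c⟩ ⟨j', c'⟩ h
  simp only [cosetPoint] at h
  have hj : s j = s j' := by
    by_contra hne
    apply hβ
    refine ⟨(c' - c) / (s j - s j'), ?_⟩
    have hne' : algebraMap K F (s j) - algebraMap K F (s j') ≠ 0 := by
      rw [← map_sub]
      simpa [sub_eq_zero] using hne
    rw [map_div₀, map_sub, map_sub, div_eq_iff hne']
    linear_combination -h
  rw [hj] at h
  simp only [add_right_inj] at h
  rw [Prod.mk.injEq]
  exact ⟨hs hj, (algebraMap K F).injective h⟩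

/-- The Lagrange denominators of the points `cosetPoint β s` all lie in
`(β ^ q - β) ^ (t - 1) K`. -/
theorem exists_prod_cosetPoint_sub {K F τ : Type*} [Field K] [Fintype K] [DecidableEq K]
    [Field F] [Algebra K F] [Fintype τ] [DecidableEq τ] (β : F) (s : τ → K) (i : τ × K) :
    ∃ d : K, ∏ i' ∈ Finset.univ.erase i, (cosetPoint β s i - cosetPoint β s i') =
      (β ^ Fintype.card K - β) ^ (Fintype.card τ - 1) * algebraMap K F d := by
  obtain ⟨j₀, c₀⟩ := i
  set q := Fintype.card K with hq
  set g : τ × K → F := fun i' ↦ if i' = (j₀, c₀) then 1 else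
    cosetPoint β s (j₀, c₀) - cosetPoint β s i' with hg
  have hprod : ∏ i' ∈ Finset.univ.erase (j₀, c₀),
      (cosetPoint β s (j₀, c₀) - cosetPoint β s i') = ∏ j, ∏ c, g (j, c) := by
    rw [← Fintype.prod_prod_type, ← Finset.mul_prod_erase _ g (Finset.mem_univ (j₀, c₀))]
    simp only [hg, if_true, one_mul]
    exact Finset.prod_congr rfl fun i' hi' ↦ by rw [if_neg (Finset.ne_of_mem_erase hi')]
  have hsame : ∏ c, g (j₀, c) = algebraMap K F (∏ c, if c = c₀ then 1 else c₀ - c) := by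
    rw [map_prod]
    refine Finset.prod_congr rfl fun c _ ↦ ?_
    by_cases hc : c = c₀
    · simp [hg, hc]
    · simp [hg, hc, cosetPoint]
  have hother : ∀ j ∈ Finset.univ.erase j₀, ∏ c, g (j, c) =
      (β ^ q - β) * algebraMap K F (s j₀ - s j) := by
    intro j hj
    have hne := Finset.ne_of_mem_erase hj
    have h1 : ∀ c, g (j, c) =
        (algebraMap K F (s j₀ - s j) * β + algebraMap K F c₀) - algebraMap K F c := by
      intro c
      simp only [hg, Prod.mk.injEq, hne, false_and, if_false, cosetPoint, map_sub]
      ring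
    obtain ⟨r, hr, n, hprime, hcard⟩ := FiniteField.card' K
    have : CharP F r := charP_of_injective_algebraMap (algebraMap K F).injective r
    have : Fact r.Prime := ⟨hprime⟩
    rw [Finset.prod_congr rfl fun c _ ↦ h1 c, FiniteField.prod_sub_algebraMap]
    have hadd : ∀ x y : F, (x + y) ^ q = x ^ q + y ^ q := by
      intro x y
      rw [hq, hcard, add_pow_char_pow]
    rw [← hq, hadd, mul_pow, ← map_pow, ← map_pow, hq, FiniteField.pow_card,
      FiniteField.pow_card]
    ring
  refine ⟨(∏ c, if c = c₀ then 1 else c₀ - c) * ∏ j ∈ Finset.univ.erase j₀, (s j₀ - s j), ?_⟩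
  rw [hprod, ← Finset.mul_prod_erase _ _ (Finset.mem_univ j₀), hsame,
    Finset.prod_congr rfl hother, Finset.prod_mul_distrib, Finset.prod_const,
    Finset.card_erase_of_mem (Finset.mem_univ _), Finset.card_univ, map_mul, map_prod, map_prod]
  ring

/-- The evaluation map of the generalized Reed–Solomon codes with nodes `a` and column
multipliers `v`; the code of dimension `k` is the image of `degreeLT F k`. -/
def grsMap {F ι : Type*} [Field F] (a v : ι → F) : F[X] →ₗ[F] ι → F where
  toFun f i := v i * f.eval (a i)
  map_add' f g := by ext i; simp [mul_add]
  map_smul' r f := by ext i; simp [mul_left_comm]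

section GRS

variable {F ι : Type*} [Field F] [Fintype ι] {a v : ι → F} {k : ℕ}

theorem le_hammingNorm_grsMap [DecidableEq F] (ha : Function.Injective a) (hv : ∀ i, v i ≠ 0)
    {f : F[X]} (hf : f ≠ 0) (hfk : f.natDegree < k) (hk : k ≤ Fintype.card ι) :
    Fintype.card ι - k + 1 ≤ hammingNorm (grsMap a v f) := by
  classical
  have hzero : (Finset.univ.filter fun i ↦ grsMap a v f i = 0).card ≤ f.natDegree := by
    rw [← Finset.card_image_of_injective _ ha]
    refine (Finset.card_le_card fun x hx ↦ ?_).trans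
      ((Multiset.toFinset_card_le _).trans f.card_roots')
    obtain ⟨i, hi, rfl⟩ := Finset.mem_image.1 hx
    have hi' := (Finset.mem_filter.1 hi).2
    simp only [grsMap, LinearMap.coe_mk, AddHom.coe_mk, mul_eq_zero, hv i, false_or] at hi'
    simpa [hf] using hi'
  have hsum := Finset.card_filter_add_card_filter_not (s := (Finset.univ : Finset ι))
    (fun i ↦ grsMap a v f i = 0)
  rw [Finset.card_univ] at hsum
  change _ ≤ (Finset.univ.filter fun i ↦ grsMap a v f i ≠ 0).card
  simp only [ne_eq]
  omega

theorem eq_zero_of_grsMap_eq_zero (ha : Function.Injective a) (hv : ∀ i, v i ≠ 0)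
    {f : F[X]} (hf : f ∈ degreeLT F k) (hk : k ≤ Fintype.card ι)
    (h : grsMap a v f = 0) : f = 0 := by
  classical
  by_contra hne
  have := le_hammingNorm_grsMap ha hv hne
    ((natDegree_lt_iff_degree_lt hne).2 (mem_degreeLT.1 hf)) hk
  simp [h] at this

theorem finrank_map_grsMap (ha : Function.Injective a) (hv : ∀ i, v i ≠ 0)
    (hk : k ≤ Fintype.card ι) :
    Module.finrank F ((degreeLT F k).map (grsMap a v)) = k := by
  have hinj : Function.Injective ((grsMap a v).domRestrict (degreeLT F k)) := by
    rw [← LinearMap.ker_eq_bot, LinearMap.ker_eq_bot']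
    exact fun f hf ↦ Subtype.ext (eq_zero_of_grsMap_eq_zero ha hv f.2 hk hf)
  rw [← LinearMap.range_domRestrict, LinearMap.finrank_range_of_inj hinj,
    (degreeLTEquiv F k).finrank_eq, Module.finrank_fin_fun]

theorem exists_hammingNorm_grsMap_eq [DecidableEq F] (ha : Function.Injective a) (hv : ∀ i, v i ≠ 0)
    (hk1 : 1 ≤ k) (hk : k ≤ Fintype.card ι) :
    ∃ f ∈ degreeLT F k, grsMap a v f ≠ 0 ∧
      hammingNorm (grsMap a v f) = Fintype.card ι - k + 1 := by
  classical
  obtain ⟨S, -, hS⟩ := Finset.exists_subset_card_eq (s := (Finset.univ : Finset ι))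
    (n := k - 1) (by rw [Finset.card_univ]; omega)
  have hnorm : hammingNorm (grsMap a v (Lagrange.nodal S a)) = Fintype.card ι - k + 1 := by
    have hset : (Finset.univ.filter fun i ↦ grsMap a v (Lagrange.nodal S a) i ≠ 0) = Sᶜ := by
      ext i
      simp [grsMap, hv, Lagrange.eval_nodal, Finset.prod_eq_zero_iff, sub_eq_zero, ha.eq_iff]
    change (Finset.univ.filter fun i ↦ grsMap a v (Lagrange.nodal S a) i ≠ 0).card = _
    rw [hset, Finset.card_compl, hS]
    omega
  refine ⟨Lagrange.nodal S a, ?_, ?_, hnorm⟩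
  · rw [mem_degreeLT, Lagrange.degree_nodal, hS]
    exact_mod_cast (by omega : k - 1 < k)
  · intro h
    simp [h] at hnorm

/-- A generalized Reed–Solomon code is Hermitian self-orthogonal as soon as the norms of its
column multipliers are proportional to the Lagrange weights of its nodes. -/
theorem sum_grsMap_mul_pow_eq_zero [DecidableEq ι] {q : ℕ} {μ : F} (ha : Function.Injective a)
    (hv : ∀ i, v i ^ (q + 1) = μ / ∏ i' ∈ Finset.univ.erase i, (a i - a i'))
    (hk : (q + 1) * (k - 1) + 2 ≤ Fintype.card ι) {f g : F[X]}
    (hf : f.natDegree ≤ k - 1) (hg : g.natDegree ≤ k - 1) :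
    ∑ i, grsMap a v f i * grsMap a v g i ^ q = 0 := by
  have hdeg : (f * g ^ q).natDegree < Fintype.card ι - 1 := by
    have h1 := natDegree_mul_le (p := f) (q := g ^ q)
    have h2 := natDegree_pow_le (p := g) (n := q)
    have h3 := Nat.mul_le_mul_left q hg
    have h4 : (q + 1) * (k - 1) = q * (k - 1) + (k - 1) := by ring
    omega
  have h := Lagrange.coeff_eq_sum (s := Finset.univ) (v := a) ha.injOn (P := f * g ^ q)
    (degree_le_natDegree.trans_lt (by rw [Finset.card_univ]; exact_mod_cast (by omega)))
  rw [Finset.card_univ, coeff_eq_zero_of_natDegree_lt hdeg] at h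
  rw [← mul_zero μ, h, Finset.mul_sum]
  refine Finset.sum_congr rfl fun i _ ↦ ?_
  have h' : grsMap a v f i * grsMap a v g i ^ q =
      v i ^ (q + 1) * (f * g ^ q).eval (a i) := by
    simp only [grsMap, LinearMap.coe_mk, AddHom.coe_mk, eval_mul, eval_pow]
    ring
  rw [h', hv]
  ring

end GRS


/-- For a prime power `q`, `1 ≤ t ≤ q`, and
`1 ≤ k ≤ ⌊(tq + q − 1)/(q + 1)⌋`, there exists a Hermitian self-orthogonal
`[tq, k, tq − k + 1]` MDS code over `F_{q²}`. -/
theorem stmt_10 (p e q t k : ℕ) (hp : p.Prime) (he : 0 < e) (hq : q = p ^ e)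
    (ht1 : 1 ≤ t) (htq : t ≤ q)
    (hk1 : 1 ≤ k) (hk : k ≤ (t * q + q - 1) / (q + 1))
    (F : Type) [Field F] [Fintype F] [DecidableEq F] (hF : Fintype.card F = q ^ 2) :
    ∃ C : Submodule F (Fin (t * q) → F),
      Module.finrank F C = k ∧
      (∀ c ∈ C, c ≠ 0 → t * q - k + 1 ≤ hammingNorm c) ∧
      (∃ c ∈ C, c ≠ 0 ∧ hammingNorm c = t * q - k + 1) ∧
      (∀ u ∈ C, ∀ c ∈ C, ∑ i, u i * (c i) ^ q = 0) := by
  classical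
  have : Fact p.Prime := ⟨hp⟩
  have hq2 : 2 ≤ q := hq ▸ hp.two_le.trans (Nat.le_self_pow he.ne' p)
  obtain ⟨alg⟩ := FiniteField.exists_algebra_galoisField (p := p) (e := e) he (hq ▸ hF)
  let K := GaloisField p e
  let := Fintype.ofFinite K
  have hK : Fintype.card K = q := by
    rw [← Nat.card_eq_fintype_card, GaloisField.card p e he.ne', hq]
  obtain ⟨β, hβ⟩ : ∃ β : F, β ∉ Set.range (algebraMap K F) := by
    by_contra! h
    have := Fintype.card_le_of_surjective _ h
    rw [hF, hK] at this
    nlinarith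
  let s : Fin t → K := fun j ↦ (Fintype.equivFinOfCardEq hK).symm (Fin.castLE htq j)
  have hs : Function.Injective s :=
    (Fintype.equivFinOfCardEq hK).symm.injective.comp (Fin.castLE_injective htq)
  let E : Fin (t * q) ≃ Fin t × K :=
    finProdFinEquiv.symm.trans ((Equiv.refl _).prodCongr (Fintype.equivFinOfCardEq hK).symm)
  let a : Fin (t * q) → F := cosetPoint β s ∘ E
  have ha : Function.Injective a := (cosetPoint_injective hβ hs).comp E.injective
  set μ : F := (β ^ q - β) ^ (t - 1) with hμ
  have hprod : ∀ i, ∏ i' ∈ Finset.univ.erase i, (a i - a i') ≠ 0 := fun i ↦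
    Finset.prod_ne_zero_iff.2 fun i' hi' ↦
      sub_ne_zero.2 fun h ↦ Finset.ne_of_mem_erase hi' (ha h).symm
  have hvex : ∀ i, ∃ v : F, v ≠ 0 ∧
      v ^ (q + 1) = μ / ∏ i' ∈ Finset.univ.erase i, (a i - a i') := by
    intro i
    obtain ⟨d, hd⟩ := exists_prod_cosetPoint_sub β s (E i)
    have hD : ∏ i' ∈ Finset.univ.erase i, (a i - a i') = μ * algebraMap K F d := by
      rw [hK, Fintype.card_fin] at hd
      rw [hμ, ← hd]
      refine Finset.prod_equiv E (by simp) (by simp [a])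
    have hne := hprod i
    rw [hD] at hne
    have hμ0 := left_ne_zero_of_mul hne
    have hd0 := right_ne_zero_of_mul hne
    obtain ⟨v, hv⟩ := FiniteField.exists_pow_card_add_one_eq (K := K) (F := F)
      (by rw [hF, hK]) d⁻¹
    rw [hK] at hv
    refine ⟨v, ?_, ?_⟩
    · rintro rfl
      rw [zero_pow (by omega), map_inv₀] at hv
      exact inv_ne_zero hd0 hv.symm
    · rw [hv, hD, map_inv₀]
      field_simp
  choose v hv0 hv using hvex
  have hkn : (q + 1) * (k - 1) + 2 ≤ t * q := by
    have h1 := (Nat.le_div_iff_mul_le (by omega)).1 hk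
    obtain ⟨k, rfl⟩ := Nat.exists_eq_add_of_le' hk1
    rw [Nat.add_sub_cancel]
    have h2 : (k + 1) * (q + 1) = (q + 1) * k + q + 1 := by ring
    omega
  have hkn' : k ≤ t * q := by
    have : k - 1 ≤ (q + 1) * (k - 1) := Nat.le_mul_of_pos_left _ (by omega)
    omega
  have hdeg : ∀ f ∈ degreeLT F k, f.natDegree ≤ k - 1 := fun f hf ↦ by
    by_cases h0 : f = 0
    · simp [h0]
    · have := (natDegree_lt_iff_degree_lt h0).2 (mem_degreeLT.1 hf)
      omega
  refine ⟨(degreeLT F k).map (grsMap a v), finrank_map_grsMap ha hv0 (by simpa using hkn'),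
    ?_, ?_, ?_⟩
  · rintro _ ⟨f, hf, rfl⟩ hne
    have hf0 : f ≠ 0 := by
      rintro rfl
      simp at hne
    have := hdeg f hf
    simpa using le_hammingNorm_grsMap (k := k) ha hv0 hf0 (by omega)
      (by simpa using hkn')
  · obtain ⟨f, hf, hne, h⟩ := exists_hammingNorm_grsMap_eq (k := k) ha hv0 hk1 (by simpa using hkn')
    exact ⟨_, ⟨f, hf, rfl⟩, hne, by simpa using h⟩
  · rintro _ ⟨f, hf, rfl⟩ _ ⟨g, hg, rfl⟩
    exact sum_grsMap_mul_pow_eq_zero ha hv (by simpa using hkn) (hdeg f hf) (hdeg g hg)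
end

section
/- Let q be a prime power, θ ∈ F_{q²} a primitive (q+1)-th root of unity, 1 ≤ t ≤ q − 1, and β₁, …, β_t ∈ F_{q²}^* representatives of distinct cosets of F_{q²}^*/⟨θ⟩. Let A_s = β_s⟨θ⟩, A = A₁ ∪ ⋯ ∪ A_t ∪ {0}, n = t(q+1)+1, and enumerate A as a₁, …, a_{n−1}, aₙ = 0. If 1 ≤ i ≤ n−1 and aᵢ = β_r θ^m ∈ A_r for some 1 ≤ r ≤ t and 0 ≤ m ≤ q, then ∏_{1 ≤ j ≤ n, j ≠ i} (aᵢ − aⱼ) = aᵢ^{q+1} ∏_{1 ≤ s ≤ t, s ≠ r} (β_r^{q+1} − β_s^{q+1}); in particular, this product lies in the subfield F_q. -/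
open Polynomial

/-- If `t * (q + 1) + 1` distinct points are all roots of `X * ∏ s, (X ^ (q + 1) - β s ^ (q + 1))`,
then this polynomial is their nodal polynomial. -/
theorem nodal_eq_X_mul_prod {F : Type*} [Field F] {q t : ℕ} (β : Fin t → F)
    (a : Fin (t * (q + 1) + 1) → F) (ha : Function.Injective a)
    (hroot : ∀ j, a j = 0 ∨ ∃ s, a j ^ (q + 1) = β s ^ (q + 1)) :
    Lagrange.nodal Finset.univ a = X * ∏ s, (X ^ (q + 1) - C (β s ^ (q + 1))) := by
  have hmonic (s : Fin t) : (X ^ (q + 1) - C (β s ^ (q + 1))).Monic :=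
    monic_X_pow_sub_C _ q.succ_ne_zero
  have hmonic_prod : (∏ s, (X ^ (q + 1) - C (β s ^ (q + 1)))).Monic :=
    monic_prod_of_monic _ _ fun s _ ↦ hmonic s
  refine (eq_of_monic_of_dvd_of_natDegree_le Lagrange.nodal_monic (monic_X.mul hmonic_prod)
    ?_ ?_).symm
  · refine Finset.prod_dvd_of_coprime (fun i _ j _ hij ↦ pairwise_coprime_X_sub_C ha hij)
      fun j _ ↦ ?_
    rw [dvd_iff_isRoot, IsRoot, eval_mul, eval_X, eval_prod]
    obtain h | ⟨s, h⟩ := hroot j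
    · rw [h, zero_mul]
    · rw [Finset.prod_eq_zero (Finset.mem_univ s) (by simp [h]), mul_zero]
  · rw [monic_X.natDegree_mul hmonic_prod, natDegree_prod_of_monic _ _ fun s _ ↦ hmonic s]
    simp only [natDegree_X_pow_sub_C, natDegree_X, Lagrange.natDegree_nodal]
    simp [add_comm]


/-- In the setting of Statement 11, if `aᵢ = β_r θ^m ∈ A_r` for some
`1 ≤ r ≤ t` and `0 ≤ m ≤ q`, then
`∏_{j ≠ i} (aᵢ − aⱼ) = aᵢ^{q+1} ∏_{s ≠ r} (β_r^{q+1} − β_s^{q+1})`, and this product lies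
in the subfield `F_q`. -/
theorem stmt_13 (p e q t : ℕ) (hp : p.Prime) (he : 0 < e) (hq : q = p ^ e)
    (F : Type) [Field F] [Fintype F] [DecidableEq F] (hF : Fintype.card F = q ^ 2)
    (θ : F) (hθ : orderOf θ = q + 1)
    (ht1 : 1 ≤ t) (ht : t ≤ q - 1)
    (β : Fin t → F) (hβ0 : ∀ s, β s ≠ 0)
    (hcoset : ∀ s s' : Fin t, s ≠ s' → ∀ m : ℕ, β s ≠ β s' * θ ^ m)
    (a : Fin (t * (q + 1) + 1) → F) (hainj : Function.Injective a)
    (hlast : a (Fin.last (t * (q + 1))) = 0)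
    (hrange : ∀ x : F, (∃ j, a j = x) ↔
        (x = 0 ∨ ∃ s : Fin t, ∃ m : ℕ, x = β s * θ ^ m))
    (i : Fin (t * (q + 1) + 1)) (r : Fin t) (m : ℕ) (hm : m ≤ q)
    (him : a i = β r * θ ^ m) :
    ∏ j ∈ Finset.univ.erase i, (a i - a j) =
      (a i) ^ (q + 1) * ∏ s ∈ Finset.univ.erase r, ((β r) ^ (q + 1) - (β s) ^ (q + 1)) ∧
    (∏ j ∈ Finset.univ.erase i, (a i - a j)) ^ q =
      ∏ j ∈ Finset.univ.erase i, (a i - a j) := by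
  have hroot_pow (s : Fin t) (k : ℕ) : (β s * θ ^ k) ^ (q + 1) = β s ^ (q + 1) := by
    rw [mul_pow, ← pow_mul, mul_comm k, pow_mul, ← hθ, pow_orderOf_eq_one, one_pow, mul_one]
  have hq0 : (q : F) = 0 := by
    have h : ((Fintype.card F : ℕ) : F) = 0 := Nat.cast_card_eq_zero F
    rw [hF, Nat.cast_pow] at h
    exact pow_eq_zero_iff two_ne_zero |>.1 h
  have hp0 : (p : F) = 0 := by
    rw [hq, Nat.cast_pow] at hq0
    exact pow_eq_zero_iff he.ne' |>.1 hq0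
  have : Fact p.Prime := ⟨hp⟩
  have : CharP F p := (CharP.charP_iff_prime_eq_zero hp).2 hp0
  have hnorm (x : F) : (x ^ (q + 1)) ^ q = x ^ (q + 1) := by
    rw [← pow_mul, show (q + 1) * q = q ^ 2 + q by ring, pow_add, ← hF, FiniteField.pow_card,
      pow_succ']
  have hnodal := nodal_eq_X_mul_prod β a hainj fun j ↦ by
    obtain h | ⟨s, k, h⟩ := (hrange (a j)).1 ⟨j, rfl⟩
    · exact .inl h
    · exact .inr ⟨s, h ▸ hroot_pow s k⟩
  have hprod : ∏ j ∈ Finset.univ.erase i, (a i - a j) =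
      a i ^ (q + 1) * ∏ s ∈ Finset.univ.erase r, (β r ^ (q + 1) - β s ^ (q + 1)) := by
    have hai : a i ^ (q + 1) = β r ^ (q + 1) := by rw [him, hroot_pow]
    rw [← Lagrange.eval_nodal, ← Lagrange.eval_nodal_derivative_eval_node_eq (Finset.mem_univ i),
      hnodal, ← Finset.mul_prod_erase _ _ (Finset.mem_univ r)]
    simp only [derivative_mul, derivative_sub, derivative_X_pow, derivative_C, derivative_X,
      eval_add, eval_mul, eval_sub, eval_pow, eval_X, eval_C, eval_prod, hai, sub_self]
    rw [← hai]
    simp [hq0]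
    ring
  refine ⟨hprod, ?_⟩
  rw [hprod, mul_pow, hnorm, ← Finset.prod_pow]
  congr 1
  refine Finset.prod_congr rfl fun s _ ↦ ?_
  nth_rw 3 [hq]
  rw [sub_pow_char_pow, ← hq, hnorm, hnorm]
end

section
/- Let p be a prime and q a power of p. For any 1 ≤ t ≤ q − 1 and 1 ≤ k ≤ t + 1 with (t, k) ≠ (q − 1, q − 1), there exists a linear code C over F_{q²} of length t(q+1)+2, dimension k, and minimum Hamming distance t(q+1)+3−k (i.e., a [t(q+1)+2, k, t(q+1)+3−k] MDS code) such that C ⊆ C^{⊥_H}, i.e., C is Hermitian self-orthogonal. -/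
open Polynomial in
/-- The value of a polynomial of degree less than `k` at a point of the projective line, where
`none` is the point at infinity. -/
noncomputable def projEval {F : Type*} [Field F] (k : ℕ) : Option F → F[X] →ₗ[F] F
  | none => lcoeff F (k - 1)
  | some a => leval a

open Polynomial in
/-- Evaluation of polynomials at the points `P` of the projective line, scaled by `v`. -/
noncomputable def grsEval {F κ : Type*} [Field F] (k : ℕ) (P : κ → Option F) (v : κ → F) :
    F[X] →ₗ[F] (κ → F) :=
  LinearMap.pi fun x => v x • projEval k (P x)

open Polynomial in
/-- The generalized Reed–Solomon code of dimension `k` on points of the projective line. -/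
noncomputable def grsCode {F κ : Type*} [Field F] (k : ℕ) (P : κ → Option F) (v : κ → F) :
    Submodule F (κ → F) :=
  (degreeLT F k).map (grsEval k P v)

section GRS

open Polynomial

variable {F κ : Type*} [Field F] {k : ℕ} {P : κ → Option F} {v : κ → F}

theorem grsEval_apply (f : F[X]) (x : κ) : grsEval k P v f x = v x * projEval k (P x) f := rfl

theorem card_projEval_zeros_lt {f : F[X]} (hf : f ∈ degreeLT F k) (hf0 : f ≠ 0)
    (Z : Finset (Option F)) (hZ : ∀ a ∈ Z, projEval k a f = 0) : Z.card < k := by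
  classical
  have hdeg : f.natDegree < k := by
    rw [mem_degreeLT] at hf
    exact (natDegree_lt_iff_degree_lt hf0).2 hf
  have hfin : Z.eraseNone.card ≤ f.natDegree := by
    apply card_le_degree_of_subset_roots
    intro a ha
    rw [mem_roots hf0]
    exact hZ (some a) (by simpa using ha)
  by_cases hn : none ∈ Z
  · have hc : f.coeff (k - 1) = 0 := hZ none hn
    have hne : f.natDegree ≠ k - 1 := by
      intro h
      rw [← h] at hc
      exact hf0 (leadingCoeff_eq_zero.1 hc)
    have := Finset.card_eraseNone_of_mem hn
    omega
  · have := Finset.card_eraseNone_of_not_mem hn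
    omega

theorem grsCode_selfOrthogonal [Fintype κ] {q : ℕ} (φ : F →+* F) (hφ : ∀ x, φ x = x ^ q)
    (h : ∀ i < k, ∀ j < k, ∑ x, v x ^ (q + 1) *
      (projEval k (P x) (X ^ i) * projEval k (P x) (X ^ j) ^ q) = 0) :
    ∀ u ∈ grsCode k P v, ∀ c ∈ grsCode k P v, ∑ x, u x * c x ^ q = 0 := by
  have key : ∀ f ∈ degreeLT F k, ∀ a, projEval k a f =
      ∑ i ∈ Finset.range k, f.coeff i * projEval k a (X ^ i) := by
    intro f hf a
    by_cases hf0 : f = 0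
    · simp [hf0]
    conv_lhs => rw [f.as_sum_range_C_mul_X_pow'
      ((natDegree_lt_iff_degree_lt hf0).2 (mem_degreeLT.1 hf))]
    rw [map_sum]
    refine Finset.sum_congr rfl fun i _ => ?_
    rw [← smul_eq_C_mul, map_smul, smul_eq_mul]
  rintro _ ⟨f, hf, rfl⟩ _ ⟨g, hg, rfl⟩
  simp_rw [grsEval_apply, key f hf, key g hg, mul_pow, ← hφ, map_sum, map_mul, Finset.mul_sum,
    Finset.sum_mul]
  rw [Finset.sum_comm]
  refine Finset.sum_eq_zero fun j hj => ?_
  rw [Finset.sum_comm]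
  refine Finset.sum_eq_zero fun i hi => ?_
  rw [← mul_zero (f.coeff i * φ (g.coeff j)),
    ← h i (Finset.mem_range.1 hi) j (Finset.mem_range.1 hj), Finset.mul_sum]
  refine Finset.sum_congr rfl fun x _ => ?_
  rw [pow_succ, ← hφ, ← hφ]
  ring

variable [Fintype κ] [DecidableEq F]

theorem le_hammingNorm_grsEval (hP : P.Injective) (hv : ∀ x, v x ≠ 0) {f : F[X]}
    (hf : f ∈ degreeLT F k) (hf0 : f ≠ 0) :
    Fintype.card κ + 1 - k ≤ hammingNorm (grsEval k P v f) := by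
  classical
  have h := card_projEval_zeros_lt hf hf0
    ((Finset.univ.filter fun x => ¬ grsEval k P v f x ≠ 0).image P) (by
      intro a ha
      simp only [Finset.mem_image, Finset.mem_filter, Finset.mem_univ, true_and, not_not] at ha
      obtain ⟨x, hx, rfl⟩ := ha
      rw [grsEval_apply] at hx
      exact (mul_eq_zero.1 hx).resolve_left (hv x))
  rw [Finset.card_image_of_injective _ hP] at h
  have h2 := Finset.card_filter_add_card_filter_not (s := (Finset.univ : Finset κ))
    (fun x => grsEval k P v f x ≠ 0)
  rw [Finset.card_univ] at h2
  unfold hammingNorm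
  omega

theorem finrank_grsCode (hP : P.Injective) (hv : ∀ x, v x ≠ 0) (hk : k ≤ Fintype.card κ) :
    Module.finrank F (grsCode k P v) = k := by
  have hinj : Function.Injective ((grsEval k P v).domRestrict (degreeLT F k)) := by
    rw [injective_iff_map_eq_zero]
    rintro ⟨f, hf⟩ h
    by_contra hf0
    have := le_hammingNorm_grsEval hP hv hf (fun h => hf0 (Subtype.ext h))
    have h' : grsEval k P v f = 0 := h
    rw [h', hammingNorm_zero] at this
    omega
  rw [grsCode, ← LinearMap.range_domRestrict, LinearMap.finrank_range_of_inj hinj,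
    (degreeLTEquiv F k).finrank_eq, Module.finrank_fin_fun]

theorem le_hammingNorm_of_mem_grsCode (hP : P.Injective) (hv : ∀ x, v x ≠ 0) {c : κ → F}
    (hc : c ∈ grsCode k P v) (hc0 : c ≠ 0) : Fintype.card κ + 1 - k ≤ hammingNorm c := by
  obtain ⟨f, hf, rfl⟩ := hc
  exact le_hammingNorm_grsEval hP hv hf (by rintro rfl; simp at hc0)

theorem exists_hammingNorm_grsCode (hP : P.Injective) (hv : ∀ x, v x ≠ 0)
    (s : Finset F) (hs : s.card + 1 = k) (hsP : ∀ a ∈ s, ∃ x, P x = some a)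
    (hk : k ≤ Fintype.card κ) :
    ∃ c ∈ grsCode k P v, c ≠ 0 ∧ hammingNorm c = Fintype.card κ + 1 - k := by
  classical
  set f : F[X] := ∏ a ∈ s, (X - C a) with hfdef
  have hmon : f.Monic := monic_prod_of_monic _ _ fun a _ => monic_X_sub_C a
  have hf0 : f ≠ 0 := hmon.ne_zero
  have hf : f ∈ degreeLT F k := by
    rw [mem_degreeLT, degree_eq_natDegree hf0, hfdef, natDegree_finsetProd_X_sub_C_eq_card]
    exact_mod_cast (by omega : s.card < k)
  have hle := le_hammingNorm_grsEval hP hv hf hf0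
  refine ⟨grsEval k P v f, ⟨f, hf, rfl⟩, ?_, le_antisymm ?_ hle⟩
  · intro h
    rw [h, hammingNorm_zero] at hle
    omega
  · have : Nonempty κ := Fintype.card_pos_iff.1 (by omega)
    choose! x hx using hsP
    have hxinj : Set.InjOn x s := by
      intro a ha b hb hab
      have := hx a ha
      rw [hab, hx b hb] at this
      exact (Option.some.inj this).symm
    have hsub : s.image x ⊆ Finset.univ.filter fun y => ¬ grsEval k P v f y ≠ 0 := by
      intro y hy
      obtain ⟨a, ha, rfl⟩ := Finset.mem_image.1 hy
      have hz : projEval k (some a) f = 0 := by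
        change f.eval a = 0
        rw [hfdef, eval_prod]
        exact Finset.prod_eq_zero ha (by simp)
      simp [grsEval_apply, hx a ha, hz]
    have h1 := Finset.card_le_card hsub
    rw [Finset.card_image_of_injOn hxinj] at h1
    have h2 := Finset.card_filter_add_card_filter_not (s := (Finset.univ : Finset κ))
      (fun x => grsEval k P v f x ≠ 0)
    rw [Finset.card_univ] at h2
    unfold hammingNorm
    omega

end GRS

section Weights

open Polynomial

variable {F : Type*} [Field F]

theorem exists_fixed_weights (φ : F →+* F) {ι : Type*} [Fintype ι] {a : ι → F}
    (ha : a.Injective) (hφ : ∀ i, φ (a i) = a i) {k : ℕ} (hk : 1 ≤ k) {h : F[X]} (hm : h.Monic)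
    (hcard : h.natDegree + k = Fintype.card ι) (h0 : ∀ i, h.eval (a i) ≠ 0)
    (hfix : ∀ i, φ (h.eval (a i)) = h.eval (a i)) :
    ∃ w : ι → F, (∀ i, w i ≠ 0) ∧ (∀ i, φ (w i) = w i) ∧
      ∀ j < k, ∑ i, w i * a i ^ j = if j = k - 1 then 1 else 0 := by
  classical
  refine ⟨fun i => h.eval (a i) / ∏ j ∈ Finset.univ.erase i, (a i - a j), fun i => ?_, fun i => ?_,
    fun j hj => ?_⟩
  · refine div_ne_zero (h0 i) (Finset.prod_ne_zero_iff.2 fun j hj => ?_)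
    exact sub_ne_zero.2 fun e => (Finset.mem_erase.1 hj).1 (ha e).symm
  · simp [map_div₀, hfix, map_prod, hφ]
  · have hd : (h * X ^ j).natDegree = h.natDegree + j := by
      rw [hm.natDegree_mul (monic_X_pow j), natDegree_X_pow]
    have hdeg : (h * X ^ j).degree < ((Finset.univ : Finset ι).card : WithBot ℕ) := by
      rw [degree_eq_natDegree (hm.mul (monic_X_pow j)).ne_zero, hd, Finset.card_univ]
      exact_mod_cast (by omega : h.natDegree + j < Fintype.card ι)
    have := Lagrange.coeff_eq_sum (s := Finset.univ) (v := a) ha.injOn hdeg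
    calc _ = (h * X ^ j).coeff ((Finset.univ : Finset ι).card - 1) := by
          rw [this]
          refine Finset.sum_congr rfl fun i _ => ?_
          rw [eval_mul, eval_pow, eval_X]
          ring
      _ = _ := by
          rw [Finset.card_univ]
          split_ifs with hjk
          · rw [show Fintype.card ι - 1 = (h * X ^ j).natDegree by omega]
            exact hm.mul (monic_X_pow j)
          · exact coeff_eq_zero_of_natDegree_lt (by omega)

theorem exists_monic_fixed_eval_ne_zero [Finite F] (φ : F →+* F) {m : ℕ} (hm : m ≠ 1) :
    ∃ h : F[X], h.Monic ∧ h.natDegree = m ∧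
      ∀ x, φ x = x → φ (h.eval x) = h.eval x ∧ h.eval x ≠ 0 := by
  rcases Nat.eq_zero_or_pos m with rfl | hpos
  · exact ⟨1, monic_one, natDegree_one, by simp⟩
  obtain ⟨n, rfl⟩ : ∃ n, m = n + 2 := ⟨m - 2, by omega⟩
  let T : {x : F // φ x = x} → {x : F // φ x = x} := fun x =>
    ⟨x.1 ^ (n + 2) - x.1 ^ (n + 1), by simp [x.2]⟩
  have hninj : ¬ T.Injective := by
    intro hT
    have : (⟨0, map_zero φ⟩ : {x : F // φ x = x}) = ⟨1, map_one φ⟩ := hT (by simp [T])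
    exact zero_ne_one (congrArg Subtype.val this)
  have hnsurj : ¬ T.Surjective := fun h => hninj (Finite.injective_iff_surjective.2 h)
  obtain ⟨c, hc⟩ := not_forall.1 hnsurj
  have hlow : (X ^ (n + 1) + C c.1 : F[X]).degree < ((n + 2 : ℕ) : WithBot ℕ) := by
    rw [degree_X_pow_add_C (Nat.succ_pos n)]
    exact_mod_cast (by omega : n + 1 < n + 2)
  refine ⟨X ^ (n + 2) - (X ^ (n + 1) + C c.1), monic_X_pow_sub hlow, ?_, fun x hx => ⟨?_, ?_⟩⟩
  · exact natDegree_eq_of_degree_eq_some (by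
      rw [degree_sub_eq_left_of_degree_lt (by rwa [degree_X_pow]), degree_X_pow])
  · simp [hx, c.2]
  · intro h0
    apply hc
    refine ⟨⟨x, hx⟩, Subtype.ext ?_⟩
    simp only [eval_sub, eval_add, eval_pow, eval_X, eval_C] at h0
    simp only [T]
    linear_combination h0

end Weights

section Cyclic

variable {F : Type*} [Field F] {q : ℕ}

theorem exists_orderOf_eq_card_sub_one [Fintype F] :
    ∃ g : F, orderOf g = Fintype.card F - 1 ∧ ∀ x ≠ 0, ∃ n : ℕ, g ^ n = x := by
  classical
  obtain ⟨u, hu⟩ := IsCyclic.exists_generator (α := Fˣ)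
  refine ⟨u, ?_, fun x hx => ?_⟩
  · rw [orderOf_units, orderOf_eq_card_of_forall_mem_zpowers hu, Nat.card_units,
      Nat.card_eq_fintype_card]
  · obtain ⟨n, hn⟩ := mem_powers_iff_mem_zpowers.2 (hu (Units.mk0 x hx))
    exact ⟨n, by simpa using congrArg Units.val hn⟩

theorem exists_pow_succ_eq_of_pow_eq [Fintype F] (hq : 2 ≤ q) (hF : Fintype.card F = q ^ 2) {c : F}
    (hc : c ≠ 0) (hcq : c ^ q = c) : ∃ y : F, y ≠ 0 ∧ y ^ (q + 1) = c := by
  obtain ⟨g, hg, hgen⟩ := exists_orderOf_eq_card_sub_one (F := F)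
  obtain ⟨n, rfl⟩ := hgen c hc
  have hfac : Fintype.card F - 1 = (q + 1) * (q - 1) := by
    rw [hF, ← Nat.sq_sub_sq, one_pow]
  have h1 : g ^ (n * (q - 1)) = 1 := by
    apply mul_right_cancel₀ hc
    rw [one_mul, ← pow_add, ← Nat.mul_succ, show (q - 1).succ = q by omega, pow_mul, hcq]
  rw [← orderOf_dvd_iff_pow_eq_one, hg, hfac] at h1
  obtain ⟨r, rfl⟩ := Nat.dvd_of_mul_dvd_mul_right (by omega) h1
  refine ⟨g ^ r, fun h => hc ?_, ?_⟩
  · rw [mul_comm, pow_mul, h, zero_pow (by omega)]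
  · rw [← pow_mul, mul_comm]

theorem sum_primitiveRoot_conj_monomials {ω : F} (hω : IsPrimitiveRoot ω (q + 1)) (b : F)
    {i j : ℕ} (hi : i < q) (hj : j < q) (hij : i ≠ j) :
    ∑ l : Fin (q + 1), (b * ω ^ (l : ℕ)) ^ i * ((b * ω ^ (l : ℕ)) ^ j) ^ q = 0 := by
  have hne : ω ^ (i + j * q) - 1 ≠ 0 := by
    rw [sub_ne_zero, Ne, hω.pow_eq_one_iff_dvd]
    intro hd
    have hd' : ((q : ℤ) + 1) ∣ (i : ℤ) - j := by
      have h1 : ((q : ℤ) + 1) ∣ (i : ℤ) + j * q := by exact_mod_cast hd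
      have h2 : ((q : ℤ) + 1) ∣ (j : ℤ) * (q + 1) := Dvd.intro_left _ rfl
      have := dvd_sub h1 h2
      rwa [show (i : ℤ) + j * q - j * (q + 1) = i - j by ring] at this
    have := Int.eq_zero_of_abs_lt_dvd hd' (by rw [abs_lt]; omega)
    omega
  have hgeom : ∑ l ∈ Finset.range (q + 1), (ω ^ (i + j * q)) ^ l = 0 := by
    have := geom_sum_mul (ω ^ (i + j * q)) (q + 1)
    rw [← pow_mul, mul_comm (i + j * q), pow_mul, hω.pow_eq_one, one_pow, sub_self] at this
    exact (mul_eq_zero.1 this).resolve_right hne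
  rw [Fin.sum_univ_eq_sum_range (fun l => (b * ω ^ l) ^ i * ((b * ω ^ l) ^ j) ^ q),
    ← mul_zero (b ^ (i + j * q)), ← hgeom, Finset.mul_sum]
  refine Finset.sum_congr rfl fun l _ => ?_
  ring

end Cyclic

section Points

variable {F : Type*} [Field F] {q t : ℕ}

/-- Zero together with the elements `g ^ i * g ^ ((q - 1) * l)`, `i < t`, `l ≤ q`. -/
def normCosetPoint (g : F) (q t : ℕ) : Option (Fin t × Fin (q + 1)) → F
  | none => 0
  | some (i, l) => g ^ (i : ℕ) * (g ^ (q - 1)) ^ (l : ℕ)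

/-- Zero together with the elements `g ^ ((q + 1) * i)`, `i < t`. -/
def normPoint (g : F) (q t : ℕ) : Option (Fin t) → F
  | none => 0
  | some i => g ^ ((q + 1) * (i : ℕ))

theorem normCosetPoint_injective {g : F} (hg0 : g ≠ 0) (hg : orderOf g = (q + 1) * (q - 1))
    (ht : t ≤ q - 1) : (normCosetPoint g q t).Injective := by
  rintro (_ | ⟨i, l⟩) (_ | ⟨i', l'⟩) h
  · rfl
  · exact absurd h.symm (by simp [normCosetPoint, hg0])
  · exact absurd h (by simp [normCosetPoint, hg0])
  · simp only [normCosetPoint, ← pow_mul, ← pow_add] at h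
    have hlt : ∀ (i : Fin t) (l : Fin (q + 1)), (i : ℕ) + (q - 1) * l ∈ Set.Iio (orderOf g) := by
      intro i l
      rw [hg, Set.mem_Iio]
      have h1 : (q - 1) * (l : ℕ) ≤ (q - 1) * q := Nat.mul_le_mul_left _ (by omega)
      have h2 : (q + 1) * (q - 1) = (q - 1) * q + (q - 1) := by ring
      omega
    have he : (i : ℕ) + (q - 1) * l = i' + (q - 1) * l' :=
      pow_injOn_Iio_orderOf (hlt i l) (hlt i' l') h
    have hi : (i : ℕ) = i' := by
      have := congrArg (· % (q - 1)) he
      simpa [Nat.mod_eq_of_lt (show (i : ℕ) < q - 1 by omega),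
        Nat.mod_eq_of_lt (show (i' : ℕ) < q - 1 by omega)] using this
    have hl : (l : ℕ) = l' := by
      rw [hi] at he
      exact Nat.eq_of_mul_eq_mul_left (by omega) (Nat.add_left_cancel he)
    rw [Fin.ext hi, Fin.ext hl]

theorem normPoint_injective {g : F} (hg0 : g ≠ 0) (hg : orderOf g = (q + 1) * (q - 1))
    (ht : t ≤ q - 1) : (normPoint g q t).Injective := by
  rintro (_ | i) (_ | i') h
  · rfl
  · exact absurd h.symm (by simp [normPoint, hg0])
  · exact absurd h (by simp [normPoint, hg0])
  · have hlt : ∀ i : Fin t, (q + 1) * (i : ℕ) ∈ Set.Iio (orderOf g) := fun i => by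
      rw [hg, Set.mem_Iio]
      exact Nat.mul_lt_mul_of_pos_left (by omega) (by omega)
    have := pow_injOn_Iio_orderOf (hlt i) (hlt i') h
    rw [Fin.ext (Nat.eq_of_mul_eq_mul_left (by omega) this)]

theorem normPoint_pow_eq {g : F} (hq : 2 ≤ q) (hg : orderOf g = (q + 1) * (q - 1)) (i) :
    normPoint g q t i ^ q = normPoint g q t i := by
  rcases i with _ | i
  · exact zero_pow (by omega)
  · have h1 : g ^ ((q + 1) * (q - 1)) = 1 := hg ▸ pow_orderOf_eq_one g
    obtain ⟨r, rfl⟩ : ∃ r, q = r + 1 := ⟨q - 1, by omega⟩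
    simp only [normPoint, Nat.add_sub_cancel] at h1 ⊢
    rw [← pow_mul, show (r + 1 + 1) * (i : ℕ) * (r + 1)
      = (r + 1 + 1) * r * i + (r + 1 + 1) * i by ring, pow_add, pow_mul, h1, one_pow, one_mul]

open Polynomial in
/-- A monic polynomial of degree `t + 1 - k` over the fixed field of `x ↦ x ^ q` without zeros
among the points `normPoint g q t`. -/
theorem exists_monic_normPoint [Finite F] {g : F} (hg0 : g ≠ 0) (hq : 2 ≤ q)
    (hg : orderOf g = (q + 1) * (q - 1)) (φ : F →+* F) (hφ : ∀ x, φ x = x ^ q) (ht : t ≤ q - 1)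
    {k : ℕ} (hk : k ≤ t + 1) (htk : (t, k) ≠ (q - 1, q - 1)) :
    ∃ h : F[X], h.Monic ∧ h.natDegree + k = t + 1 ∧
      (∀ i, h.eval (normPoint g q t i) ≠ 0) ∧
      ∀ i, φ (h.eval (normPoint g q t i)) = h.eval (normPoint g q t i) := by
  by_cases hm : t + 1 - k = 1
  · have hlt : t + 1 ≤ q - 1 := by
      by_contra hc
      exact htk (Prod.ext (by simp only; omega) (by simp only; omega))
    have hfix := fun i => (hφ _).trans (normPoint_pow_eq (t := t + 1) hq hg i)
    have hcast : ∀ i, normPoint g q t i = normPoint g q (t + 1) (i.map Fin.castSucc) := by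
      rintro (_ | i) <;> rfl
    refine ⟨X - C (normPoint g q (t + 1) (some (Fin.last t))), monic_X_sub_C _, ?_, fun i => ?_,
      fun i => ?_⟩
    · rw [natDegree_X_sub_C]
      omega
    · rw [eval_sub, eval_X, eval_C, sub_ne_zero, hcast, (normPoint_injective hg0 hg hlt).ne_iff]
      rcases i with _ | i <;> simp
    · rw [eval_sub, eval_X, eval_C, map_sub, hfix, hcast, hfix]
  · obtain ⟨h, h1, h2, h3⟩ := exists_monic_fixed_eval_ne_zero φ hm
    have hfix := fun i => (hφ _).trans (normPoint_pow_eq (t := t) hq hg i)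
    exact ⟨h, h1, by omega, fun i => (h3 _ (hfix i)).2, fun i => (h3 _ (hfix i)).1⟩

/-- The monomials of degree less than `k` are pairwise orthogonal for the Hermitian form
weighted by `v ^ (q + 1)`. -/
theorem sum_projEval_monomials_eq_zero {g : F} (hq : 2 ≤ q) (hqF : (q : F) = 0)
    (hg : orderOf g = (q + 1) * (q - 1)) {k : ℕ} (hkq : k ≤ q)
    {w : Option (Fin t) → F}
    (hw : ∀ j < k, ∑ i, w i * normPoint g q t i ^ j = if j = k - 1 then 1 else 0)
    {v : Option (Option (Fin t × Fin (q + 1))) → F} (hvinf : v none ^ (q + 1) = -1)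
    (hvzero : v (some none) ^ (q + 1) = w none)
    (hvsome : ∀ i l, v (some (some (i, l))) ^ (q + 1) = w (some i))
    {i j : ℕ} (hi : i < k) (hj : j < k) :
    ∑ x, v x ^ (q + 1) * (projEval k (x.map (normCosetPoint g q t)) (Polynomial.X ^ i) *
      projEval k (x.map (normCosetPoint g q t)) (Polynomial.X ^ j) ^ q) = 0 := by
  have hω : IsPrimitiveRoot (g ^ (q - 1)) (q + 1) :=
    (hg ▸ IsPrimitiveRoot.orderOf g : IsPrimitiveRoot g ((q + 1) * (q - 1))).pow
      (Nat.mul_pos (by omega) (by omega)) (mul_comm _ _)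
  simp only [Fintype.sum_option, Fintype.sum_prod_type, hvinf, hvzero, hvsome, Option.map_none,
    Option.map_some, projEval, normCosetPoint, Polynomial.lcoeff_apply, Polynomial.leval_apply,
    Polynomial.coeff_X_pow, Polynomial.eval_pow, Polynomial.eval_X, ← Finset.mul_sum]
  by_cases hij : i = j
  · subst hij
    have hs := hw i hi
    rw [Fintype.sum_option] at hs
    simp only [normPoint] at hs
    have hone : ∀ b : Fin t, ∑ l : Fin (q + 1), (g ^ (b : ℕ) * (g ^ (q - 1)) ^ (l : ℕ)) ^ i *
        ((g ^ (b : ℕ) * (g ^ (q - 1)) ^ (l : ℕ)) ^ i) ^ q = (g ^ ((q + 1) * (b : ℕ))) ^ i := by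
      intro b
      have : ∀ l : Fin (q + 1), (g ^ (b : ℕ) * (g ^ (q - 1)) ^ (l : ℕ)) ^ i *
          ((g ^ (b : ℕ) * (g ^ (q - 1)) ^ (l : ℕ)) ^ i) ^ q = (g ^ ((q + 1) * (b : ℕ))) ^ i := by
        intro l
        have h1 := hω.pow_eq_one
        calc _ = (g ^ ((q + 1) * (b : ℕ))) ^ i * ((g ^ (q - 1)) ^ (q + 1)) ^ ((l : ℕ) * i) := by
              ring
          _ = _ := by rw [h1, one_pow, mul_one]
      rw [Finset.sum_congr rfl fun l _ => this l]
      simp [hqF]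
    simp only [hone]
    have h0 : (0 : F) ^ i * (0 ^ i) ^ q = 0 ^ i := by
      rcases Nat.eq_zero_or_pos i with rfl | h
      · simp
      · simp [h.ne']
    rw [h0, hs]
    by_cases hik : i = k - 1
    · simp [hik]
    · simp [hik, Ne.symm hik]
  · have h0 : (0 : F) ^ i * (0 ^ j) ^ q = 0 := by
      rcases Nat.eq_zero_or_pos i with rfl | h
      · simp [show j ≠ 0 by omega, show q ≠ 0 by omega]
      · simp [h.ne']
    have h1 : (if k - 1 = i then (1 : F) else 0) * (if k - 1 = j then 1 else 0) ^ q = 0 := by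
      by_cases hik : k - 1 = i
      · simp [show k - 1 ≠ j by omega, show q ≠ 0 by omega]
      · simp [hik]
    rw [h0, h1]
    simp [sum_primitiveRoot_conj_monomials hω _ (hi.trans_le hkq) (hj.trans_le hkq) hij]

end Points

/-- Let `p` be a prime and `q` a power of `p`.  For any `1 ≤ t ≤ q − 1` and
`1 ≤ k ≤ t + 1` with `(t, k) ≠ (q − 1, q − 1)`, there exists a Hermitian self-orthogonal
`[t(q+1)+2, k, t(q+1)+3−k]` MDS code over `F_{q²}`. -/
theorem stmt_15 (p e q t k : ℕ) (hp : p.Prime) (he : 0 < e) (hq : q = p ^ e)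
    (ht1 : 1 ≤ t) (ht : t ≤ q - 1)
    (hk1 : 1 ≤ k) (hk : k ≤ t + 1) (htk : (t, k) ≠ (q - 1, q - 1))
    (F : Type) [Field F] [Fintype F] [DecidableEq F] (hF : Fintype.card F = q ^ 2) :
    ∃ C : Submodule F (Fin (t * (q + 1) + 2) → F),
      Module.finrank F C = k ∧
      (∀ c ∈ C, c ≠ 0 → t * (q + 1) + 3 - k ≤ hammingNorm c) ∧
      (∃ c ∈ C, c ≠ 0 ∧ hammingNorm c = t * (q + 1) + 3 - k) ∧
      (∀ u ∈ C, ∀ c ∈ C, ∑ i, u i * (c i) ^ q = 0) := by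
  have hq2 : 2 ≤ q := by omega
  have : Fact p.Prime := ⟨hp⟩
  have : CharP F p := charP_of_card_eq_prime_pow (f := e * 2) (by rw [hF, hq, pow_mul])
  have hqF : (q : F) = 0 := by
    rw [hq, Nat.cast_pow, CharP.cast_eq_zero, zero_pow he.ne']
  let φ : F →+* F := iterateFrobenius F p e
  have hφ : ∀ x, φ x = x ^ q := fun x => by rw [hq]; exact iterateFrobenius_def p e x
  obtain ⟨g, hg, -⟩ := exists_orderOf_eq_card_sub_one (F := F)
  rw [hF, show q ^ 2 - 1 = (q + 1) * (q - 1) by rw [← Nat.sq_sub_sq, one_pow]] at hg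
  have hg0 : g ≠ 0 := by
    rintro rfl
    have := pow_orderOf_eq_one (0 : F)
    rw [hg, zero_pow (Nat.mul_pos (by omega) (by omega)).ne'] at this
    exact zero_ne_one this
  obtain ⟨h, hmon, hdeg, hne, hfix⟩ := exists_monic_normPoint hg0 hq2 hg φ hφ ht hk htk
  obtain ⟨w, hw0, hwφ, hw⟩ := exists_fixed_weights φ (normPoint_injective hg0 hg ht)
    (fun i => (hφ _).trans (normPoint_pow_eq hq2 hg i)) hk1 hmon (by simpa using hdeg) hne hfix
  choose y hy0 hy using fun i =>
    exists_pow_succ_eq_of_pow_eq hq2 hF (hw0 i) ((hφ _).symm.trans (hwφ i))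
  obtain ⟨z, hz0, hz⟩ := exists_pow_succ_eq_of_pow_eq hq2 hF (neg_ne_zero.2 (one_ne_zero (α := F)))
    ((hφ _).symm.trans (by rw [map_neg, map_one]))
  let v : Option (Option (Fin t × Fin (q + 1))) → F := fun x =>
    x.elim z fun x => y (x.map Prod.fst)
  have hv : ∀ x, v x ≠ 0 := by
    rintro (_ | x)
    · exact hz0
    · exact hy0 _
  let E : Fin (t * (q + 1) + 2) ≃ Option (Option (Fin t × Fin (q + 1))) :=
    Fintype.equivOfCardEq (by simp)
  let P : Fin (t * (q + 1) + 2) → Option F := fun x => (E x).map (normCosetPoint g q t)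
  have hP : P.Injective :=
    (Option.map_injective (normCosetPoint_injective hg0 hg ht)).comp E.injective
  have hlen : t ≤ t * (q + 1) := Nat.le_mul_of_pos_right t (by omega)
  have hcard : t * (q + 1) + 3 - k = Fintype.card (Fin (t * (q + 1) + 2)) + 1 - k := by
    rw [Fintype.card_fin]
  have hkcard : k ≤ Fintype.card (Fin (t * (q + 1) + 2)) := by
    rw [Fintype.card_fin]
    omega
  refine ⟨grsCode k P (v ∘ E), finrank_grsCode hP (fun x => hv _) hkcard, fun c hc hc0 => ?_, ?_,
    grsCode_selfOrthogonal φ hφ fun i hi j hj => ?_⟩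
  · rw [hcard]
    exact le_hammingNorm_of_mem_grsCode hP (fun x => hv _) hc hc0
  · rw [hcard]
    have hinj : Set.InjOn (fun i => g ^ i) (Finset.range (k - 1)) := by
      refine pow_injOn_Iio_orderOf.mono fun i hi => ?_
      have hi' : i < k - 1 := by simpa using hi
      have : 1 * (q - 1) ≤ (q + 1) * (q - 1) := Nat.mul_le_mul_right _ (by omega)
      rw [Set.mem_Iio, hg]
      omega
    refine exists_hammingNorm_grsCode hP (fun x => hv _)
      ((Finset.range (k - 1)).image fun i => g ^ i) ?_ ?_ hkcard
    · rw [Finset.card_image_of_injOn hinj, Finset.card_range]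
      omega
    · intro a ha
      obtain ⟨i, hi, rfl⟩ := Finset.mem_image.1 ha
      rw [Finset.mem_range] at hi
      exact ⟨E.symm (some (some (⟨i, by omega⟩, 0))), by simp [P, normCosetPoint]⟩
  · rw [← sum_projEval_monomials_eq_zero (v := v) hq2 hqF hg (by omega) hw hz (hy none)
      (fun i _ => hy (some i)) hi hj]
    exact E.sum_comp fun x => v x ^ (q + 1) * (projEval k (x.map (normCosetPoint g q t)) _ *
      projEval k (x.map (normCosetPoint g q t)) _ ^ q)
end

section
/- Let p be an odd prime and q a power of p. Then there exists a linear code C over F_{q²} of length q² + 1, dimension q − 1, and minimum Hamming distance q² − q + 3 (i.e., a [q² + 1, q − 1, q² − q + 3] MDS code) such that C ⊆ C^{⊥_H}, i.e., C is Hermitian self-orthogonal. -/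
open Polynomial

lemma hammingNorm_comp_equiv {ι κ F : Type*} [Fintype ι] [Fintype κ] [Zero F] [DecidableEq F]
    (σ : ι ≃ κ) (c : κ → F) :
    hammingNorm (c ∘ σ) = hammingNorm c := by
  simp only [hammingNorm, Finset.card_filter, Function.comp_apply]
  exact Equiv.sum_comp σ (fun i => if c i ≠ 0 then 1 else 0)

section ExtendedGRS

variable {F : Type*} [Field F]

/-- The evaluation map of the extended generalised Reed-Solomon code: a polynomial is evaluated
at every field element, the point at infinity reads off its coefficient of degree `d`, and the
coordinates are scaled by `v`. -/
noncomputable def extendedGRS (v : Option F → F) (d : ℕ) : F[X] →ₗ[F] (Option F → F) where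
  toFun f o := v o * o.elim (f.coeff d) (fun x => f.eval x)
  map_add' f g := by
    funext o
    cases o <;> simp [mul_add]
  map_smul' c f := by
    funext o
    cases o <;> simp [mul_left_comm]

lemma extendedGRS_none (v : Option F → F) (d : ℕ) (f : F[X]) :
    extendedGRS v d f none = v none * f.coeff d := rfl

lemma extendedGRS_some (v : Option F → F) (d : ℕ) (f : F[X]) (x : F) :
    extendedGRS v d f (some x) = v (some x) * f.eval x := rfl

lemma finrank_degreeLT (n : ℕ) : Module.finrank F (degreeLT F n) = n := by
  rw [(degreeLTEquiv F n).finrank_eq, Module.finrank_fin_fun]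

lemma natDegree_lt_of_mem_degreeLT {f : F[X]} {n : ℕ} (hn : 0 < n) (hf : f ∈ degreeLT F n) :
    f.natDegree < n := by
  by_cases h0 : f = 0
  · rwa [h0, natDegree_zero]
  · exact (natDegree_lt_iff_degree_lt h0).2 (mem_degreeLT.1 hf)

variable [Fintype F] [DecidableEq F]

lemma hammingNorm_extendedGRS {v : Option F → F} (hv : ∀ o, v o ≠ 0) (d : ℕ) (f : F[X]) :
    hammingNorm (extendedGRS v d f) + (Finset.univ.filter fun x : F => f.eval x = 0).card =
      Fintype.card F + if f.coeff d = 0 then 0 else 1 := by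
  have hcard := Finset.card_filter_add_card_filter_not (s := (Finset.univ : Finset F))
    (fun x : F => f.eval x = 0)
  rw [Finset.card_univ] at hcard
  simp only [hammingNorm, Finset.card_filter, Fintype.sum_option, extendedGRS_none,
    extendedGRS_some, mul_eq_zero, hv, ne_eq, false_or, ite_not] at hcard ⊢
  omega

lemma card_eval_eq_zero_le {f : F[X]} (hf : f ≠ 0) :
    (Finset.univ.filter fun x : F => f.eval x = 0).card ≤ f.natDegree := by
  refine le_trans (Finset.card_le_card (t := f.roots.toFinset) ?_)
    ((Multiset.toFinset_card_le _).trans (card_roots' f))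
  intro x hx
  simpa [hf, IsRoot.def] using hx

lemma le_hammingNorm_extendedGRS {v : Option F → F} (hv : ∀ o, v o ≠ 0) {d : ℕ} {f : F[X]}
    (hf : f ≠ 0) (hd : f ∈ degreeLT F (d + 1)) :
    Fintype.card F + 1 ≤ hammingNorm (extendedGRS v d f) + d := by
  have hw := hammingNorm_extendedGRS hv d f
  have hz := card_eval_eq_zero_le hf
  have hdeg := natDegree_lt_of_mem_degreeLT d.succ_pos hd
  split_ifs at hw with hc
  · have : f.natDegree ≠ d := by
      rintro rfl
      exact hf (leadingCoeff_eq_zero.1 hc)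
    omega
  · omega

lemma exists_hammingNorm_extendedGRS_eq {v : Option F → F} (hv : ∀ o, v o ≠ 0) {d : ℕ}
    (hd : d ≤ Fintype.card F) :
    ∃ f ∈ degreeLT F (d + 1), f ≠ 0 ∧
      hammingNorm (extendedGRS v d f) + d = Fintype.card F + 1 := by
  obtain ⟨S, -, hS⟩ := Finset.exists_subset_card_eq (s := (Finset.univ : Finset F)) hd
  have hmonic : (∏ a ∈ S, (X - C a)).Monic := monic_prod_of_monic _ _ fun a _ => monic_X_sub_C a
  have hdeg : (∏ a ∈ S, (X - C a)).natDegree = d := by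
    rw [natDegree_prod_of_monic _ _ fun a _ => monic_X_sub_C a]
    simp [hS]
  refine ⟨∏ a ∈ S, (X - C a), ?_, hmonic.ne_zero, ?_⟩
  · rw [mem_degreeLT, ← natDegree_lt_iff_degree_lt hmonic.ne_zero, hdeg]
    exact Nat.lt_succ_self d
  · have hw := hammingNorm_extendedGRS hv d (∏ a ∈ S, (X - C a))
    have hcoeff : (∏ a ∈ S, (X - C a)).coeff d = 1 := by
      rw [← hdeg]; exact hmonic
    have hfilter : (Finset.univ.filter fun x : F => (∏ a ∈ S, (X - C a)).eval x = 0) = S := by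
      ext x
      simp [eval_prod, Finset.prod_eq_zero_iff, sub_eq_zero]
    rw [hcoeff, hfilter, hS, if_neg one_ne_zero] at hw
    exact hw

end ExtendedGRS

section HermitianWeights

variable {F : Type*} [Field F] [Fintype F] {q : ℕ}

lemma pow_sq_card (hF : Fintype.card F = q ^ 2) (x : F) : (x ^ q) ^ q = x := by
  rw [← pow_mul, ← sq, ← hF, FiniteField.pow_card]

lemma orderOf_of_generates_units [DecidableEq F] (hF : Fintype.card F = q ^ 2) {g : Fˣ}
    (hg : ∀ x, x ∈ Subgroup.zpowers g) : orderOf g = (q - 1) * (q + 1) := by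
  rw [orderOf_eq_card_of_forall_mem_zpowers hg, Nat.card_eq_fintype_card, Fintype.card_units, hF,
    mul_comm, ← Nat.sq_sub_sq, one_pow]

lemma exists_pow_succ_eq (hq : 1 < q) (hF : Fintype.card F = q ^ 2) {y : F} (hy : y ≠ 0)
    (hyq : y ^ q = y) : ∃ z : F, z ≠ 0 ∧ z ^ (q + 1) = y := by
  classical
  obtain ⟨g, hg⟩ := IsCyclic.exists_generator (α := Fˣ)
  have ho := orderOf_of_generates_units hF hg
  obtain ⟨m, hm⟩ := mem_powers_iff_mem_zpowers.2 (hg (Units.mk0 y hy))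
  have hm' : g ^ m = Units.mk0 y hy := hm
  have h1 : (Units.mk0 y hy) ^ (q - 1) = 1 := by
    apply Units.ext
    have : y ^ (q - 1) * y = 1 * y := by rw [← pow_succ, Nat.sub_add_cancel hq.le, hyq, one_mul]
    simpa using mul_right_cancel₀ hy this
  rw [← hm', ← pow_mul, ← orderOf_dvd_iff_pow_eq_one, ho, mul_comm m] at h1
  obtain ⟨k, rfl⟩ := Nat.dvd_of_mul_dvd_mul_left (by omega) h1
  refine ⟨((g ^ k : Fˣ) : F), Units.ne_zero _, ?_⟩
  rw [← Units.val_pow_eq_pow_val, ← pow_mul, mul_comm k, hm', Units.val_mk0]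

lemma exists_subfield_nonsquare (hq : 1 < q) (hodd : Odd q) (hF : Fintype.card F = q ^ 2) :
    ∃ η : F, η ^ q = η ∧ ∀ t : F, t ^ q = t → t ^ 2 ≠ η := by
  classical
  obtain ⟨g, hg⟩ := IsCyclic.exists_generator (α := Fˣ)
  have ho := orderOf_of_generates_units hF hg
  refine ⟨((g ^ (q + 1) : Fˣ) : F), ?_, fun t ht hη => ?_⟩
  · rw [← Units.val_pow_eq_pow_val, ← pow_mul]
    congr 1
    have : (q + 1) * q = (q - 1) * (q + 1) + (q + 1) := by
      obtain ⟨r, rfl⟩ := Nat.exists_eq_add_of_lt hq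
      simp only [Nat.add_sub_cancel]
      ring_nf
    rw [this, pow_add, ← ho, pow_orderOf_eq_one, one_mul]
  · have ht0 : t ≠ 0 := by
      rintro rfl
      exact Units.ne_zero (g ^ (q + 1)) (by rw [← hη]; simp)
    obtain ⟨r, rfl⟩ := hodd
    have h1 : t ^ (2 * r) = 1 := by
      have : t ^ (2 * r) * t = 1 * t := by rw [← pow_succ, ht, one_mul]
      exact mul_right_cancel₀ ht0 this
    rw [pow_mul, hη, ← Units.val_pow_eq_pow_val, Units.val_eq_one, ← pow_mul,
      ← orderOf_dvd_iff_pow_eq_one, ho, Nat.add_sub_cancel] at h1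
    have := Nat.le_of_dvd (Nat.mul_pos (Nat.succ_pos _) (by omega)) h1
    nlinarith

/-- The weight `(x + x ^ q) ^ 2 - η` at the field elements, and `2` at infinity. -/
def hermitianWeight (q : ℕ) (η : F) : Option F → F
  | none => 2
  | some x => (x + x ^ q) ^ 2 - η

lemma sum_pow_swap (hF : Fintype.card F = q ^ 2) (a b : ℕ) :
    ∑ x : F, x ^ (a + q * b) = ∑ x : F, x ^ (b + q * a) := by
  have hbij : Function.Bijective fun x : F => x ^ q :=
    Function.Involutive.bijective (pow_sq_card hF)
  rw [← hbij.sum_comp fun x => x ^ (a + q * b)]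
  refine Finset.sum_congr rfl fun x _ => ?_
  rw [pow_add, pow_mul (x ^ q), pow_sq_card hF, ← pow_mul, ← pow_add, add_comm]

lemma sum_pow_card_sub_one : ∑ x : F, x ^ (Fintype.card F - 1) = -1 := by
  classical
  have h : ∀ x : F, x ^ (Fintype.card F - 1) = if x = 0 then 0 else 1 := by
    intro x
    split_ifs with hx
    · rw [hx, zero_pow (Nat.sub_pos_of_lt Fintype.one_lt_card).ne']
    · exact FiniteField.pow_card_sub_one_eq_one x hx
  simp only [h]
  have hsplit : ∀ x : F, (if x = 0 then (0 : F) else 1) = 1 - if x = 0 then 1 else 0 := by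
    intro x
    split_ifs <;> simp
  simp [hsplit]

lemma sum_hermitianWeight_mul_pow {d : ℕ} (hF : Fintype.card F = (d + 2) ^ 2) (η : F) {i j : ℕ}
    (hi : i ≤ d) (hj : j ≤ d) :
    ∑ x : F, hermitianWeight (d + 2) η (some x) * x ^ (i + (d + 2) * j) =
      if i = d ∧ j = d then -2 else 0 := by
  have hlow : ∀ a b : ℕ, a ≤ d + 2 → b ≤ d → ∑ x : F, x ^ (a + (d + 2) * b) = 0 := by
    intro a b ha hb
    apply FiniteField.sum_pow_lt_card_sub_one
    rw [hF]
    apply Nat.lt_sub_of_add_lt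
    have := Nat.mul_le_mul_left (d + 2) hb
    nlinarith
  have hmid : ∑ x : F, x ^ ((i + 1) + (d + 2) * (j + 1)) = if i = d ∧ j = d then -1 else 0 := by
    split_ifs with h
    · rw [← sum_pow_card_sub_one, hF, h.1, h.2]
      refine Finset.sum_congr rfl fun x _ => congrArg _ ?_
      symm
      apply Nat.sub_eq_of_eq_add
      ring
    · apply FiniteField.sum_pow_lt_card_sub_one
      rw [hF]
      apply Nat.lt_sub_of_add_lt
      have h' : i + 1 ≤ d ∨ j + 1 ≤ d := by omega
      have h2 := Nat.mul_le_mul_left (d + 2) (Nat.add_le_add_right hj 1)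
      rcases h' with h' | h'
      · nlinarith
      · have := Nat.mul_le_mul_left (d + 2) h'
        nlinarith
  have hexp : ∀ x : F, hermitianWeight (d + 2) η (some x) * x ^ (i + (d + 2) * j) =
      x ^ ((i + 2) + (d + 2) * j) + 2 * x ^ ((i + 1) + (d + 2) * (j + 1)) +
        x ^ (i + (d + 2) * (j + 2)) - η * x ^ (i + (d + 2) * j) := by
    intro x
    simp only [hermitianWeight]
    ring
  simp only [hexp, Finset.sum_add_distrib, Finset.sum_sub_distrib, ← Finset.mul_sum]
  rw [sum_pow_swap hF i (j + 2), hlow (i + 2) j (by omega) hj, hlow (j + 2) i (by omega) hi,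
    hlow i j (by omega) hj, hmid]
  split_ifs <;> ring

end HermitianWeights

lemma sum_extendedGRS_mul_pow_eq_zero {F : Type*} [Field F] [Fintype F] {d p e : ℕ} [CharP F p]
    (hp : p.Prime) (hq : d + 2 = p ^ e) (hF : Fintype.card F = (d + 2) ^ 2) {η : F}
    {v : Option F → F} (hv : ∀ o, v o ^ (d + 2 + 1) = hermitianWeight (d + 2) η o) {f g : F[X]}
    (hf : f ∈ degreeLT F (d + 1)) (hg : g ∈ degreeLT F (d + 1)) :
    ∑ o, extendedGRS v d f o * (extendedGRS v d g o) ^ (d + 2) = 0 := by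
  have := Fact.mk hp
  have hpow : ∀ x : F, (g.eval x) ^ (d + 2) =
      ∑ j ∈ Finset.range (d + 1), g.coeff j ^ (d + 2) * x ^ ((d + 2) * j) := by
    intro x
    rw [eval_eq_sum_range' (natDegree_lt_of_mem_degreeLT d.succ_pos hg), hq, sum_pow_char_pow]
    refine Finset.sum_congr rfl fun j _ => ?_
    rw [mul_pow, ← pow_mul, mul_comm j]
  have hsome : ∀ x : F, extendedGRS v d f (some x) * (extendedGRS v d g (some x)) ^ (d + 2) =
      ∑ i ∈ Finset.range (d + 1), ∑ j ∈ Finset.range (d + 1), f.coeff i * g.coeff j ^ (d + 2) *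
        (hermitianWeight (d + 2) η (some x) * x ^ (i + (d + 2) * j)) := by
    intro x
    rw [extendedGRS_some, extendedGRS_some, mul_pow, hpow, ← hv,
      eval_eq_sum_range' (natDegree_lt_of_mem_degreeLT d.succ_pos hf), mul_mul_mul_comm,
      ← pow_succ', Finset.sum_mul_sum, Finset.mul_sum]
    refine Finset.sum_congr rfl fun i _ => ?_
    rw [Finset.mul_sum]
    refine Finset.sum_congr rfl fun j _ => ?_
    rw [pow_add x]
    ring
  have hsum : ∑ x : F, extendedGRS v d f (some x) * (extendedGRS v d g (some x)) ^ (d + 2) =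
      f.coeff d * g.coeff d ^ (d + 2) * -2 := by
    simp only [hsome]
    rw [Finset.sum_comm, Finset.sum_eq_single_of_mem d (by simp), Finset.sum_comm,
      Finset.sum_eq_single_of_mem d (by simp)]
    · rw [← Finset.mul_sum, sum_hermitianWeight_mul_pow hF η le_rfl le_rfl, if_pos ⟨rfl, rfl⟩]
    · intro j hj hjd
      rw [← Finset.mul_sum, sum_hermitianWeight_mul_pow hF η le_rfl
        (Nat.lt_succ_iff.1 (Finset.mem_range.1 hj)), if_neg (by simp [hjd]), mul_zero]
    · intro i hi hid
      rw [Finset.sum_comm]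
      refine Finset.sum_eq_zero fun j hj => ?_
      rw [← Finset.mul_sum, sum_hermitianWeight_mul_pow hF η
        (Nat.lt_succ_iff.1 (Finset.mem_range.1 hi)) (Nat.lt_succ_iff.1 (Finset.mem_range.1 hj)),
        if_neg (by simp [hid]), mul_zero]
  rw [Fintype.sum_option, hsum, extendedGRS_none, extendedGRS_none, mul_pow, mul_mul_mul_comm,
    ← pow_succ', hv]
  simp only [hermitianWeight]
  ring

lemma exists_pow_eq_hermitianWeight {F : Type*} [Field F] [Fintype F] {q p e : ℕ} [CharP F p]
    (hp : p.Prime) (hodd : p ≠ 2) (he : 0 < e) (hq : q = p ^ e) (hF : Fintype.card F = q ^ 2) :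
    ∃ (η : F) (v : Option F → F), (∀ o, v o ≠ 0) ∧ ∀ o, v o ^ (q + 1) = hermitianWeight q η o := by
  have := Fact.mk hp
  have hq1 : 1 < q := hq ▸ Nat.one_lt_pow he.ne' hp.one_lt
  have hadd : ∀ x y : F, (x + y) ^ q = x ^ q + y ^ q := hq ▸ fun x y => add_pow_char_pow x y p e
  have hsub : ∀ x y : F, (x - y) ^ q = x ^ q - y ^ q := hq ▸ fun x y => sub_pow_char_pow x y e
  obtain ⟨η, hη, hns⟩ := exists_subfield_nonsquare hq1
    (hq ▸ (hp.odd_of_ne_two hodd).pow) hF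
  have htr : ∀ x : F, (x + x ^ q) ^ q = x + x ^ q := fun x => by
    rw [hadd, pow_sq_card hF, add_comm]
  have hW : ∀ o, ∃ z : F, z ≠ 0 ∧ z ^ (q + 1) = hermitianWeight q η o := by
    rintro (_ | x)
    · refine exists_pow_succ_eq hq1 hF (Ring.two_ne_zero ?_) ?_
      · rwa [ringChar.eq F p]
      · simp only [hermitianWeight]
        rw [← one_add_one_eq_two, hadd, one_pow]
    · refine exists_pow_succ_eq hq1 hF (sub_ne_zero.2 (hns _ (htr x))) ?_
      simp only [hermitianWeight]
      rw [hsub, hη, pow_right_comm, htr]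
  choose v hv0 hv using hW
  exact ⟨η, v, hv0, hv⟩

/-- Let `p` be an odd prime and `q` a power of `p`.  Then there exists a
Hermitian self-orthogonal `[q² + 1, q − 1, q² − q + 3]` MDS code over `F_{q²}`. -/
theorem stmt_16 (p e q : ℕ) (hp : p.Prime) (hodd : p ≠ 2) (he : 0 < e) (hq : q = p ^ e)
    (F : Type) [Field F] [Fintype F] [DecidableEq F] (hF : Fintype.card F = q ^ 2) :
    ∃ C : Submodule F (Fin (q ^ 2 + 1) → F),
      Module.finrank F C = q - 1 ∧
      (∀ c ∈ C, c ≠ 0 → q ^ 2 - q + 3 ≤ hammingNorm c) ∧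
      (∃ c ∈ C, c ≠ 0 ∧ hammingNorm c = q ^ 2 - q + 3) ∧
      (∀ u ∈ C, ∀ c ∈ C, ∑ i, u i * (c i) ^ q = 0) := by
  have := Fact.mk hp
  have hcard : Fintype.card F = p ^ (e * 2) := by rw [hF, hq, pow_mul]
  have : CharP F p := charP_of_card_eq_prime_pow hcard
  obtain ⟨η, v, hv0, hv⟩ := exists_pow_eq_hermitianWeight hp hodd he hq hF
  obtain ⟨d, rfl⟩ : ∃ d, q = d + 2 :=
    ⟨q - 2, (Nat.sub_add_cancel (hq ▸ Nat.one_lt_pow he.ne' hp.one_lt)).symm⟩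
  have hσ : Fintype.card (Fin ((d + 2) ^ 2 + 1)) = Fintype.card (Option F) := by simp [hF]
  let σ := Fintype.equivOfCardEq hσ
  let φ := (LinearMap.funLeft F F σ).comp (extendedGRS v d)
  have hφ : ∀ f, φ f = extendedGRS v d f ∘ σ := fun _ => rfl
  have hle : d + 2 ≤ (d + 2) ^ 2 := Nat.le_self_pow two_ne_zero _
  have hmin : ∀ f ∈ degreeLT F (d + 1), f ≠ 0 →
      (d + 2) ^ 2 - (d + 2) + 3 ≤ hammingNorm (φ f) := by
    intro f hf hf0
    have := le_hammingNorm_extendedGRS hv0 hf0 hf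
    rw [hφ, hammingNorm_comp_equiv]
    omega
  have hinj : Function.Injective (φ.domRestrict (degreeLT F (d + 1))) := by
    refine (injective_iff_map_eq_zero _).2 fun f hf => ?_
    by_contra hf0
    have := hmin f f.2 fun h => hf0 (Subtype.ext h)
    rw [LinearMap.domRestrict_apply] at hf
    rw [hf, hammingNorm_zero] at this
    omega
  refine ⟨(degreeLT F (d + 1)).map φ, ?_, ?_, ?_, ?_⟩
  · rw [← LinearMap.range_domRestrict, LinearMap.finrank_range_of_inj hinj, finrank_degreeLT]
    rfl
  · rintro _ ⟨f, hf, rfl⟩ hf0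
    exact hmin f hf fun h => hf0 (by rw [h, map_zero])
  · obtain ⟨f, hf, hf0, hw⟩ := exists_hammingNorm_extendedGRS_eq hv0 (d := d) (by omega)
    have hn : hammingNorm (φ f) = (d + 2) ^ 2 - (d + 2) + 3 := by
      rw [hφ, hammingNorm_comp_equiv]
      omega
    refine ⟨φ f, ⟨f, hf, rfl⟩, fun h => ?_, hn⟩
    rw [h, hammingNorm_zero] at hn
    omega
  · rintro _ ⟨f, hf, rfl⟩ _ ⟨g, hg, rfl⟩
    rw [← sum_extendedGRS_mul_pow_eq_zero hp hq hF hv hf hg]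
    exact Equiv.sum_comp σ fun o => extendedGRS v d f o * (extendedGRS v d g o) ^ (d + 2)
end

section
/- There is no linear code C over F₄ of length 5, dimension 1, and minimum Hamming distance 5 that is Hermitian self-orthogonal; that is, there is no Hermitian self-orthogonal [5, 1, 5] MDS code over F₄. -/
/-- There is no Hermitian self-orthogonal `[5, 1, 5]` MDS code over `F₄`. -/
theorem stmt_17 (F : Type) [Field F] [Fintype F] [DecidableEq F]
    (hF : Fintype.card F = 4) :
    ¬ ∃ C : Submodule F (Fin 5 → F),
      Module.finrank F C = 1 ∧
      (∀ c ∈ C, c ≠ 0 → 5 ≤ hammingNorm c) ∧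
      (∃ c ∈ C, c ≠ 0 ∧ hammingNorm c = 5) ∧
      (∀ u ∈ C, ∀ c ∈ C, ∑ i, u i * (c i) ^ 2 = 0) := by
  rintro ⟨C, -, -, ⟨c, hc, -, hc5⟩, hself⟩
  have hne : ∀ i, c i ≠ 0 := by
    have huniv : (Finset.univ.filter fun i => c i ≠ 0) = Finset.univ :=
      Finset.eq_univ_of_card _ (by simpa [hammingNorm] using hc5)
    intro i
    simpa using huniv.ge (Finset.mem_univ i)
  have hcube : ∀ i, c i * c i ^ 2 = 1 := fun i => by
    have h := FiniteField.pow_card_sub_one_eq_one (c i) (hne i)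
    rw [hF] at h
    rw [← pow_succ', ← h]
  have hfour : (4 : F) = 0 := by
    have h := FiniteField.cast_card_eq_zero F
    rw [hF] at h
    exact_mod_cast h
  have hfive : (5 : F) = 0 := by
    simpa [hcube] using hself c hc c hc
  exact one_ne_zero (α := F) (by linear_combination hfive - hfour)
end
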